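/- arXiv:2502.06765 — 4 statements merged into one kernel-verified Lean document; each statement's English description precedes it below -/
import Mathlib

section
/- Fix α ∈ (0,1), n ≥ 1, a measurable space Z, a model class F, and a loss ℓ. Let L̂_α(F,·) : Z^n → [0,∞] be a valid distribution-free lower bound on the model class risk of F, and assume the relevant maps are measurable. Then for every probability distribution P on Z and every N ≥ n, if Z_1, Z_2, …, Z_N are i.i.d. from P, D_n = (Z_1,…,Z_n), and D_N = (Z_1,…,Z_N), it holds that P^N{ L̂_α(F, D_n) > R̂(F, D_N) } ≤ α + n²/(2N). -/
open MeasureTheory ProbabilityTheory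
open scoped ENNReal NNReal BigOperators

/-- The birthday bound on the number of injections `Fin n → Fin N`. -/
lemma birthday_bound {n N : ℕ} (hN : n ≤ N) (hN0 : 0 < N) :
    (N : ℝ) ^ n * (1 - n * (n - 1) / (2 * N)) ≤ N.descFactorial n := by
  induction n with
  | zero => simp
  | succ n ih =>
    have hnN : n ≤ N := by lia
    have hNpos : (0 : ℝ) < N := by exact_mod_cast hN0
    have hle : (n : ℝ) ≤ N := by exact_mod_cast hnN
    have hx : 0 ≤ (n : ℝ) * (n - 1) / (2 * N) := by
      rcases Nat.eq_zero_or_pos n with rfl | h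
      · simp
      · have : (1 : ℝ) ≤ n := by exact_mod_cast h
        have := sub_nonneg.2 this
        positivity
    rw [Nat.descFactorial_succ, Nat.cast_mul, Nat.cast_sub hnN]
    refine le_trans ?_ (mul_le_mul_of_nonneg_left (ih hnN) (sub_nonneg.2 hle))
    have hexp : ((N : ℝ) - n) * (N ^ n * (1 - n * (n - 1) / (2 * N))) -
        N ^ (n + 1) * (1 - ((n + 1 : ℕ) : ℝ) * ((n + 1 : ℕ) - 1) / (2 * N)) =
        N ^ n * (n * (n * (n - 1) / (2 * N))) := by
      push_cast
      field_simp
      ring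
    have : 0 ≤ (N : ℝ) ^ n * (n * (n * (n - 1) / (2 * N))) := by positivity
    linarith

/-- Passing from sampling with replacement to sampling without replacement: if at most a fraction
`α` of the maps `Fin n → Fin N` is bad, then at most a fraction `α + n² / (2N)` of the permutations
of `Fin N` has a bad restriction to the first `n` points. -/
lemma card_perm_le_of_card_fun_le {n N : ℕ} (hN : n ≤ N) (hN0 : 0 < N) {α : ℝ}
    (bad : Finset (Fin n → Fin N)) (hbad : (bad.card : ℝ) ≤ α * N ^ n) :
    ((Finset.univ.filter fun σ : Equiv.Perm (Fin N) =>
        (fun i => σ (Fin.castLE hN i)) ∈ bad).card : ℝ) ≤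
      (α + n ^ 2 / (2 * N)) * N.factorial := by
  classical
  set K := (Finset.univ.filter fun σ : Equiv.Perm (Fin N) =>
    (fun i => σ (Fin.castLE hN i)) ∈ bad).card
  have hNpos : (0 : ℝ) < N := by exact_mod_cast hN0
  have hKle : (K : ℝ) ≤ N.factorial := by
    have := Finset.card_filter_le (Finset.univ : Finset (Equiv.Perm (Fin N)))
      (fun σ => (fun i => σ (Fin.castLE hN i)) ∈ bad)
    rw [Finset.card_univ, Fintype.card_perm, Fintype.card_fin] at this
    exact_mod_cast this
  have hinj (j : Fin n ↪ Fin N) :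
      (Finset.univ.filter fun σ : Equiv.Perm (Fin N) => (fun i => σ (j i)) ∈ bad).card = K := by
    obtain ⟨τ, hτ⟩ := Equiv.Perm.exists_extending_pair (Fin.castLE hN) j
      (Fin.castLE_injective hN) j.injective
    refine Finset.card_equiv (Equiv.mulRight τ) fun σ => ?_
    simp [hτ]
  have hperm (σ : Equiv.Perm (Fin N)) :
      (Finset.univ.filter fun j : Fin n → Fin N => (fun i => σ (j i)) ∈ bad).card = bad.card :=
    Finset.card_equiv (Equiv.arrowCongr (Equiv.refl _) σ) fun j => by
      simp only [Finset.mem_filter, Finset.mem_univ, true_and]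
      rfl
  have hdouble : N.descFactorial n * K ≤ N.factorial * bad.card := by
    calc N.descFactorial n * K
        = ∑ j : Fin n ↪ Fin N,
          (Finset.univ.filter fun σ : Equiv.Perm (Fin N) => (fun i => σ (j i)) ∈ bad).card := by
          simp [hinj, Fintype.card_embedding_eq]
      _ = ∑ j ∈ Finset.univ.map ⟨fun j : Fin n ↪ Fin N => (j : Fin n → Fin N),
            DFunLike.coe_injective⟩,
          (Finset.univ.filter fun σ : Equiv.Perm (Fin N) => (fun i => σ (j i)) ∈ bad).card := by
          rw [Finset.sum_map]; rfl
      _ ≤ ∑ j : Fin n → Fin N,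
          (Finset.univ.filter fun σ : Equiv.Perm (Fin N) => (fun i => σ (j i)) ∈ bad).card :=
          Finset.sum_le_sum_of_subset (Finset.subset_univ _)
      _ = ∑ σ : Equiv.Perm (Fin N),
          (Finset.univ.filter fun j : Fin n → Fin N => (fun i => σ (j i)) ∈ bad).card := by
          simp only [Finset.card_filter]
          exact Finset.sum_comm
      _ = N.factorial * bad.card := by simp [hperm, Fintype.card_perm]
  have hdouble' : (N.descFactorial n : ℝ) * K ≤ N.factorial * bad.card := by
    exact_mod_cast hdouble
  have hpow : (0 : ℝ) < (N : ℝ) ^ n := by positivity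
  have hbirth : (N : ℝ) ^ n * (1 - n ^ 2 / (2 * N)) ≤ N.descFactorial n := by
    refine le_trans (mul_le_mul_of_nonneg_left ?_ hpow.le) (birthday_bound hN hN0)
    gcongr
    have : (0 : ℝ) ≤ n := by positivity
    nlinarith
  have hscaled : (N : ℝ) ^ n * ((1 - n ^ 2 / (2 * N)) * K) ≤ N ^ n * (α * N.factorial) := by
    calc (N : ℝ) ^ n * ((1 - n ^ 2 / (2 * N)) * K)
        = (N : ℝ) ^ n * (1 - n ^ 2 / (2 * N)) * K := by ring
      _ ≤ N.descFactorial n * (K : ℝ) := by gcongr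
      _ ≤ N.factorial * (bad.card : ℝ) := hdouble'
      _ ≤ N.factorial * (α * N ^ n) := by gcongr
      _ = N ^ n * (α * N.factorial) := by ring
  have hcancel := le_of_mul_le_mul_left hscaled hpow
  have : (n : ℝ) ^ 2 / (2 * N) * K ≤ n ^ 2 / (2 * N) * N.factorial := by gcongr
  linarith

/-- The empirical measure of the points `D 0, …, D (N - 1)`. -/
noncomputable def empiricalMeasure {Z : Type*} [MeasurableSpace Z] {N : ℕ} (D : Fin N → Z) :
    Measure Z :=
  (uniformOn (Set.univ : Set (Fin N))).map D

lemma isProbabilityMeasure_empiricalMeasure {Z : Type*} [MeasurableSpace Z] {N : ℕ} (hN0 : 0 < N)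
    (D : Fin N → Z) : IsProbabilityMeasure (empiricalMeasure D) := by
  have : Nonempty (Fin N) := ⟨⟨0, hN0⟩⟩
  exact Measure.isProbabilityMeasure_map (measurable_of_finite D).aemeasurable

lemma lintegral_empiricalMeasure {Z : Type*} [MeasurableSpace Z] {N : ℕ} (D : Fin N → Z)
    {g : Z → ℝ≥0∞} (hg : Measurable g) :
    ∫⁻ z, g z ∂empiricalMeasure D = (∑ i, g (D i)) / N := by
  rw [empiricalMeasure, lintegral_map hg (measurable_of_finite D), lintegral_fintype]
  simp [uniformOn_univ, ENNReal.div_eq_inv_mul, Finset.mul_sum, mul_comm]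

lemma pi_empiricalMeasure_apply {Z : Type*} [MeasurableSpace Z] {N : ℕ} (hN0 : 0 < N) (n : ℕ)
    (D : Fin N → Z) {s : Set (Fin n → Z)} (hs : MeasurableSet s) :
    Measure.pi (fun _ : Fin n => empiricalMeasure D) s =
      Measure.count {j : Fin n → Fin N | (fun i => D (j i)) ∈ s} / (N : ℝ≥0∞) ^ n := by
  have := isProbabilityMeasure_empiricalMeasure hN0 D
  have : Nonempty (Fin N) := ⟨⟨0, hN0⟩⟩
  have hmap := Measure.pi_map_pi (μ := fun _ : Fin n => uniformOn (Set.univ : Set (Fin N)))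
    (f := fun _ => D) (hμ := fun _ => by
      change SigmaFinite (empiricalMeasure D); infer_instance)
    (fun _ => (measurable_of_finite D).aemeasurable)
  change _ = Measure.pi (fun _ : Fin n => empiricalMeasure D) at hmap
  rw [← hmap, Measure.map_apply (measurable_of_finite _) hs,
    ← uniformOn_pi (f := fun _ : Fin n => (Set.univ : Set (Fin N))), Set.pi_univ, uniformOn_univ]
  simp
  rfl

lemma sum_indicator_one_eq_card {ι X : Type*} [Fintype ι] (E : Set X) (g : ι → X)
    [DecidablePred fun i => g i ∈ E] :
    ∑ i, E.indicator (1 : X → ℝ≥0∞) (g i) = (Finset.univ.filter fun i => g i ∈ E).card := by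
  classical
  simp [Set.indicator_apply]

open scoped Classical in
/-- Exchangeability: a measurable event that contains, for almost every sample, at most a fraction
`c` of the permutations of the sample has probability at most `c`. -/
lemma measure_pi_le_of_card_perm_le {Z : Type*} [MeasurableSpace Z] (P : Measure Z)
    [IsProbabilityMeasure P] {N : ℕ} {E : Set (Fin N → Z)} (hE : MeasurableSet E) {c : ℝ≥0∞}
    (h : ∀ᵐ D ∂Measure.pi (fun _ : Fin N => P),
      ((Finset.univ.filter fun σ : Equiv.Perm (Fin N) => (fun i => D (σ i)) ∈ E).card : ℝ≥0∞) ≤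
        c * N.factorial) :
    Measure.pi (fun _ : Fin N => P) E ≤ c := by
  set μ := Measure.pi (fun _ : Fin N => P)
  have hpres (σ : Equiv.Perm (Fin N)) :
      MeasurePreserving (fun (D : Fin N → Z) i => D (σ i)) μ μ := by
    have := measurePreserving_piCongrLeft (fun _ : Fin N => P) σ⁻¹
    convert this using 1
    ext D i
    obtain ⟨j, rfl⟩ := (σ⁻¹ : Equiv.Perm (Fin N)).surjective i
    rw [MeasurableEquiv.coe_piCongrLeft, Equiv.piCongrLeft_apply_apply]
    simp
  have hm : Measurable (E.indicator (1 : (Fin N → Z) → ℝ≥0∞)) := measurable_one.indicator hE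
  have hsum : ∫⁻ D, ∑ σ : Equiv.Perm (Fin N),
      E.indicator (1 : (Fin N → Z) → ℝ≥0∞) (fun i => D (σ i)) ∂μ = N.factorial * μ E := by
    have hmσ (σ : Equiv.Perm (Fin N)) : Measurable fun D : Fin N → Z =>
        E.indicator (1 : (Fin N → Z) → ℝ≥0∞) (fun i => D (σ i)) := hm.comp (hpres σ).measurable
    rw [lintegral_finsetSum _ fun σ _ => hmσ σ]
    simp_rw [(hpres _).lintegral_comp hm, lintegral_indicator_one hE]
    simp [Fintype.card_perm]
  have hle : N.factorial * μ E ≤ N.factorial * c := by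
    simp_rw [← hsum, sum_indicator_one_eq_card]
    refine (lintegral_mono_ae h).trans ?_
    simp [mul_comm]
  exact (ENNReal.mul_le_mul_iff_right (by simp [Nat.factorial_ne_zero]) (by simp)).1 hle

open scoped Classical in
/-- A version of exchangeability for the outer measure of the event `R < T`, where `T` is measurable
and `R` is symmetric but possibly not measurable. -/
lemma measure_pi_lt_le_of_symmetric {Z : Type*} [MeasurableSpace Z] (P : Measure Z)
    [IsProbabilityMeasure P] {N : ℕ} {R T : (Fin N → Z) → ℝ≥0∞} (hT : Measurable T)
    (hR : ∀ (σ : Equiv.Perm (Fin N)) (D : Fin N → Z), R (fun i => D (σ i)) = R D) {c : ℝ≥0∞}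
    (h : ∀ D : Fin N → Z,
      ((Finset.univ.filter fun σ : Equiv.Perm (Fin N) => R D < T (fun i => D (σ i))).card : ℝ≥0∞) ≤
        c * N.factorial) :
    Measure.pi (fun _ : Fin N => P) {D | R D < T D} ≤ c := by
  set μ := Measure.pi (fun _ : Fin N => P)
  let v : ℚ → ℝ≥0∞ := fun q => (Real.toNNReal q : ℝ≥0∞)
  let S : ℚ → Set (Fin N → Z) := fun q => {D | R D < v q}
  -- a symmetric measurable hull of `S q`
  let H : ℚ → Set (Fin N → Z) := fun q =>
    ⋂ σ : Equiv.Perm (Fin N), (fun D i => D (σ i)) ⁻¹' toMeasurable μ (S q)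
  have hperm (σ : Equiv.Perm (Fin N)) : Measurable fun (D : Fin N → Z) i => D (σ i) := by fun_prop
  have hHmeas (q : ℚ) : MeasurableSet (H q) :=
    .iInter fun σ => hperm σ (measurableSet_toMeasurable _ _)
  have hSH (q : ℚ) : S q ⊆ H q := fun D hD => Set.mem_iInter.2 fun σ =>
    subset_toMeasurable μ _ (by simpa [S, hR] using hD)
  have hHS (q : ℚ) : H q ⊆ toMeasurable μ (S q) := fun D hD => Set.mem_iInter.1 hD 1
  have hHsymm (q : ℚ) (σ : Equiv.Perm (Fin N)) (D : Fin N → Z)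
      (hD : (fun i => D (σ i)) ∈ H q) : D ∈ H q := Set.mem_iInter.2 fun τ => by
    simpa using Set.mem_iInter.1 hD (σ⁻¹ * τ)
  let E : Set (Fin N → Z) := ⋃ q, {D | v q < T D} ∩ H q
  have hEmeas : MeasurableSet E :=
    .iUnion fun q => (measurableSet_lt measurable_const hT).inter (hHmeas q)
  have hsub : {D | R D < T D} ⊆ E := fun D hD => by
    obtain ⟨q, -, h1, h2⟩ := (ENNReal.lt_iff_exists_rat_btwn).1 hD
    exact Set.mem_iUnion.2 ⟨q, h2, hSH q h1⟩
  refine (measure_mono hsub).trans (measure_pi_le_of_card_perm_le P hEmeas ?_)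
  -- samples too many permutations of which exceed the level `v q`
  let M : ℚ → Set (Fin N → Z) := fun q => {D | c * N.factorial <
    ((Finset.univ.filter fun σ : Equiv.Perm (Fin N) => v q < T (fun i => D (σ i))).card : ℝ≥0∞)}
  have hMmeas (q : ℚ) : MeasurableSet (M q) := by
    have hq : MeasurableSet {D | v q < T D} := measurableSet_lt measurable_const hT
    refine measurableSet_lt measurable_const ?_
    have hmσ (σ : Equiv.Perm (Fin N)) : Measurable fun D : Fin N → Z =>
        {D | v q < T D}.indicator (1 : (Fin N → Z) → ℝ≥0∞) (fun i => D (σ i)) :=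
      (measurable_one.indicator hq).comp (hperm σ)
    have := Finset.measurable_fun_sum Finset.univ fun σ _ => hmσ σ
    simpa only [sum_indicator_one_eq_card, Set.mem_ofPred_eq] using this
  have hnull (q : ℚ) : μ (H q ∩ M q) = 0 := by
    refine measure_mono_null (Set.inter_subset_inter_left _ (hHS q)) ?_
    rw [Measure.measure_toMeasurable_inter (hMmeas q) (measure_ne_top _ _)]
    convert measure_empty (μ := μ)
    refine Set.eq_empty_of_forall_notMem fun D hD => (h D).not_gt (hD.2.trans_le ?_)
    exact_mod_cast Finset.card_le_card
      (Finset.monotone_filter_right _ fun σ _ hσ => hD.1.trans hσ)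
  have hae : ∀ᵐ D ∂μ, ∀ q, D ∉ H q ∩ M q :=
    ae_all_iff.2 fun q => measure_eq_zero_iff_ae_notMem.1 (hnull q)
  filter_upwards [hae] with D hD
  set A := Finset.univ.filter fun σ : Equiv.Perm (Fin N) => (fun i => D (σ i)) ∈ E
  rcases A.eq_empty_or_nonempty with hempty | hne
  · simp [hempty]
  have hwit (σ : Equiv.Perm (Fin N)) (hσ : σ ∈ A) : ∃ q, v q < T (fun i => D (σ i)) ∧ D ∈ H q := by
    obtain ⟨q, hq1, hq2⟩ := Set.mem_iUnion.1 (Finset.mem_filter.1 hσ).2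
    exact ⟨q, hq1, hHsymm q σ D hq2⟩
  choose! q hqT hqH using hwit
  obtain ⟨σ₀, hσ₀, hmin⟩ := A.exists_min_image (fun σ => v (q σ)) hne
  have hnot : D ∉ M (q σ₀) := fun hM => hD (q σ₀) ⟨hqH σ₀ hσ₀, hM⟩
  refine le_trans ?_ (not_lt.1 hnot)
  exact_mod_cast Finset.card_le_card fun σ hσ =>
    Finset.mem_filter.2 ⟨Finset.mem_univ _, (hmin σ hσ).trans_lt (hqT σ hσ)⟩

/-- Hardness in the high-complexity regime.  If `L̂` is a valid
distribution-free lower bound on the model class risk at level `α` and sample size `n`,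
then for every probability measure `P` and every `N ≥ n`, the probability (under `P^N`)
that `L̂` evaluated on the first `n` points exceeds the empirical model-class risk on all
`N` points is at most `α + n²/(2N)`. -/
theorem hardness_high_complexity
    {Z F : Type*} [MeasurableSpace Z]
    (ℓ : F → Z → ℝ≥0) (hℓmeas : ∀ f : F, Measurable (ℓ f))
    (α : ℝ) (hα : α ∈ Set.Ioo (0 : ℝ) 1) (n : ℕ) (hn : 1 ≤ n)
    (L : (Fin n → Z) → ℝ≥0∞) (hLmeas : Measurable L)
    (hvalid : ∀ Q : Measure Z, IsProbabilityMeasure Q →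
      ENNReal.ofReal (1 - α) ≤
        Measure.pi (fun _ : Fin n => Q)
          {D | L D ≤ ⨅ f : F, ∫⁻ z, (ℓ f z : ℝ≥0∞) ∂Q})
    (P : Measure Z) [IsProbabilityMeasure P]
    (N : ℕ) (hN : n ≤ N) :
    Measure.pi (fun _ : Fin N => P)
        {D | (⨅ f : F, (∑ i, (ℓ f (D i) : ℝ≥0∞)) / N) < L (fun i : Fin n => D (Fin.castLE hN i))}
      ≤ ENNReal.ofReal (α + n ^ 2 / (2 * N)) := by
  classical
  have hN0 : 0 < N := by lia
  have hα1 : 0 ≤ α := hα.1.le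
  have hc : 0 ≤ α + (n : ℝ) ^ 2 / (2 * N) := by positivity
  refine measure_pi_lt_le_of_symmetric P (R := fun D => ⨅ f, (∑ i, (ℓ f (D i) : ℝ≥0∞)) / N)
    (hLmeas.comp (by fun_prop)) (fun σ D => ?_) fun D => ?_
  · exact iInf_congr fun f => by rw [Equiv.sum_comp σ fun i => (ℓ f (D i) : ℝ≥0∞)]
  set r := ⨅ f, (∑ i, (ℓ f (D i) : ℝ≥0∞)) / N with hr
  let bad : Finset (Fin n → Fin N) := Finset.univ.filter fun j => r < L (fun i => D (j i))
  have hbad : (bad.card : ℝ) ≤ α * N ^ n := by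
    have hv := hvalid _ (isProbabilityMeasure_empiricalMeasure hN0 D)
    simp_rw [lintegral_empiricalMeasure D (hℓmeas _).coe_nnreal_ennreal, ← hr] at hv
    rw [pi_empiricalMeasure_apply hN0 n D (measurableSet_le hLmeas measurable_const)] at hv
    have hcount : Measure.count {j : Fin n → Fin N | (fun i => D (j i)) ∈ {D | L D ≤ r}} =
        ((badᶜ.card : ℝ≥0) : ℝ≥0∞) := by
      rw [show {j : Fin n → Fin N | (fun i => D (j i)) ∈ {D | L D ≤ r}} = (badᶜ : Finset _) by
        ext; simp [bad]]
      rw [Measure.count_apply_finset]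
      simp
    rw [hcount, ENNReal.le_div_iff_mul_le (by simp [hN0.ne']) (by simp)] at hv
    have hv' : (1 - α) * (N : ℝ) ^ n ≤ badᶜ.card := by
      have := ENNReal.toReal_mono (by simp) hv
      simpa [ENNReal.toReal_ofReal (sub_nonneg.2 hα.2.le)] using this
    have hcard : (bad.card : ℝ) + badᶜ.card = N ^ n := by
      have := bad.card_add_card_compl
      rw [Fintype.card_fun, Fintype.card_fin, Fintype.card_fin] at this
      exact_mod_cast this
    linarith
  have hfin := card_perm_le_of_card_fun_le hN hN0 bad hbad
  have hfin' := ENNReal.ofReal_le_ofReal hfin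
  rw [ENNReal.ofReal_mul hc, ENNReal.ofReal_natCast, ENNReal.ofReal_natCast] at hfin'
  simpa [bad] using hfin'
end

section
/- Fix α ∈ (0,1) and let α_0 + α_1 = α with α_0, α_1 > 0. Fix any n ≥ 1 and m ≥ 1 with m ≤ n(n−1)/(2 log(1/α_0)). Then L̂^pwc_α(F_pwc^(m), D_n) := α_1 · R̂(F_pwc^(n−1), D_n) is a valid distribution-free lower bound on R_P(F_pwc^(m)); that is, for every probability distribution P on ℝ^d × ℝ, P^n{ D_n : R_P(F_pwc^(m)) ≥ α_1 · R̂(F_pwc^(n−1), D_n) } ≥ 1 − α. -/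
open MeasureTheory
open scoped ENNReal NNReal BigOperators

/-- The class of piecewise constant functions `ℝ^d → ℝ` taking at most `m` values. -/
def Fpwc (d m : ℕ) : Set ((Fin d → ℝ) → ℝ) :=
  {f | ∃ s : Finset ℝ, s.card ≤ m ∧ ∀ x, f x ∈ s}

/-- Model class risk of `Fpwc d m` under squared loss, for a distribution `P` on
`ℝ^d × ℝ`. -/
noncomputable def pwcClassRisk (d m : ℕ) (P : Measure ((Fin d → ℝ) × ℝ)) : ℝ≥0∞ :=
  ⨅ f ∈ Fpwc d m, ∫⁻ z, ENNReal.ofReal ((f z.1 - z.2) ^ 2) ∂P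

/-- Empirical model class risk of `Fpwc d m` under squared loss, on a dataset of `n`
points. -/
noncomputable def pwcEmpClassRisk (d m n : ℕ) (D : Fin n → (Fin d → ℝ) × ℝ) : ℝ≥0∞ :=
  ⨅ f ∈ Fpwc d m, (∑ i, ENNReal.ofReal ((f (D i).1 - (D i).2) ^ 2)) / n

open Finset in
theorem sum_ite_mem_range_embedding {κ ι : Type*} [Fintype κ] [Fintype ι] [DecidableEq ι]
    (e : κ ↪ ι) (f : ι → ℝ) :
    ∑ i, (if i ∈ univ.map e then f i else 0) = ∑ k, f (e k) := by
  rw [Finset.sum_ite_mem, Finset.univ_inter, Finset.sum_map]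

/-- Moving the mass of an injective tuple from a light point to a heavy one increases its weight. -/
theorem prod_embedding_le_prod_swap {κ ι : Type*} [Fintype κ] [DecidableEq ι]
    {p : ι → ℝ} (hp : ∀ i, 0 ≤ p i) {i j : ι} (hij : p j ≤ p i) (e : κ ↪ ι)
    (hj : ∃ l, e l = j) :
    ∏ k, p (e k) ≤ ∏ k, p (Equiv.swap i j (e k)) := by
  classical
  by_cases hi : ∃ k, e k = i
  · obtain ⟨k, rfl⟩ := hi
    obtain ⟨l, rfl⟩ := hj
    refine le_of_eq ?_
    rw [← Equiv.prod_comp (Equiv.swap k l)]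
    exact Finset.prod_congr rfl fun x _ => by rw [e.injective.map_swap]
  · refine Finset.prod_le_prod (fun k _ => hp _) fun k _ => ?_
    by_cases hk : e k = j
    · rw [hk, Equiv.swap_apply_right]
      exact hij
    · rw [Equiv.swap_apply_of_ne_of_ne (fun h => hi ⟨k, h⟩) hk]

/-- The probability that `n` independent draws from a distribution `p` on `ι` are distinct. -/
noncomputable def distinctProb {ι : Type*} [Fintype ι] [DecidableEq ι] (p : ι → ℝ) (n : ℕ) : ℝ :=
  ∑ e : Fin n ↪ ι, ∏ k, p (e k)

theorem distinctProb_nonneg {ι : Type*} [Fintype ι] [DecidableEq ι] {p : ι → ℝ}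
    (hp : ∀ i, 0 ≤ p i) (n : ℕ) : 0 ≤ distinctProb p n :=
  Finset.sum_nonneg fun _ _ => Finset.prod_nonneg fun _ _ => hp _

theorem distinctProb_succ {ι : Type*} [Fintype ι] [DecidableEq ι] {p : ι → ℝ}
    (hp1 : ∑ i, p i = 1) (n : ℕ) :
    distinctProb p (n + 1) =
      distinctProb p n - ∑ e : Fin n ↪ ι, (∏ k, p (e k)) * ∑ k, p (e k) := by
  classical
  rw [distinctProb, ← (Equiv.embeddingFinSucc n ι).symm.sum_comp, Fintype.sum_sigma, distinctProb,
    ← Finset.sum_sub_distrib]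
  refine Finset.sum_congr rfl fun e _ => ?_
  simp only [Fin.prod_univ_succ, Equiv.coe_embeddingFinSucc_symm, Fin.cons_zero, Fin.cons_succ]
  rw [← Finset.sum_mul, ← sum_ite_mem_range_embedding e p]
  have h : ∑ x : {i // i ∉ Set.range e}, p x
      = ∑ i, (if i ∈ Finset.univ.map e then 0 else p i) := by
    rw [← Finset.sum_subtype (Finset.univ.filter fun i => i ∉ Set.range e) (by simp) p,
      Finset.sum_filter]
    refine Finset.sum_congr rfl fun i _ => ?_
    by_cases hi : ∃ k, e k = i <;> simp_all
  have h2 : ∑ i, (if i ∈ Finset.univ.map e then 0 else p i)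
      + ∑ i, (if i ∈ Finset.univ.map e then p i else 0) = 1 := by
    rw [← Finset.sum_add_distrib, ← hp1]
    exact Finset.sum_congr rfl fun i _ => by split_ifs <;> simp
  rw [h, eq_sub_iff_add_eq.mpr h2]
  ring

theorem mul_distinctProb_le {ι : Type*} [Fintype ι] [DecidableEq ι] {p : ι → ℝ}
    (hp : ∀ i, 0 ≤ p i) (hp1 : ∑ i, p i = 1) (n : ℕ) :
    n * distinctProb p n ≤
      Fintype.card ι * ∑ e : Fin n ↪ ι, (∏ k, p (e k)) * ∑ k, p (e k) := by
  classical
  set w : ι → ℝ := fun i =>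
    ∑ e : Fin n ↪ ι, if i ∈ Finset.univ.map e then ∏ k, p (e k) else 0 with hw
  have hmono : Monovary w p := by
    intro j i hji
    simp only [hw]
    rw [← (Equiv.embeddingCongr (Equiv.refl (Fin n)) (Equiv.swap i j)).sum_comp
      (fun e : Fin n ↪ ι => if i ∈ Finset.univ.map e then ∏ k, p (e k) else 0)]
    refine Finset.sum_le_sum fun e _ => ?_
    have hiff : i ∈ Finset.univ.map
        (Equiv.embeddingCongr (Equiv.refl (Fin n)) (Equiv.swap i j) e) ↔
        j ∈ Finset.univ.map e := by
      simp [Equiv.swap_apply_eq_iff]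
    simp only [hiff]
    split_ifs with h
    · simpa using prod_embedding_le_prod_swap hp hji.le e (by simpa using h)
    · rfl
  have hsum : ∑ i, w i = n * distinctProb p n := by
    simp only [hw]
    rw [Finset.sum_comm, distinctProb, Finset.mul_sum]
    refine Finset.sum_congr rfl fun e _ => ?_
    rw [sum_ite_mem_range_embedding e fun _ => ∏ k, p (e k)]
    simp
  have hsum2 : ∑ i, w i * p i = ∑ e : Fin n ↪ ι, (∏ k, p (e k)) * ∑ k, p (e k) := by
    simp only [hw, Finset.sum_mul]
    rw [Finset.sum_comm]
    refine Finset.sum_congr rfl fun e _ => ?_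
    rw [← sum_ite_mem_range_embedding e p, Finset.mul_sum]
    exact Finset.sum_congr rfl fun i _ => by split_ifs <;> simp
  have h := hmono.sum_mul_sum_le_card_mul_sum
  rwa [hsum, hsum2, hp1, mul_one] at h

/-- **Birthday bound** for an arbitrary distribution on a finite type. -/
theorem distinctProb_le_exp {ι : Type*} [Fintype ι] [DecidableEq ι] [Nonempty ι] {p : ι → ℝ}
    (hp : ∀ i, 0 ≤ p i) (hp1 : ∑ i, p i = 1) (n : ℕ) :
    distinctProb p n ≤ Real.exp (-((n : ℝ) * (n - 1) / (2 * Fintype.card ι))) := by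
  have hc : (0 : ℝ) < Fintype.card ι := by exact_mod_cast Fintype.card_pos
  induction n with
  | zero => simp [distinctProb]
  | succ n ih =>
    have h1 : distinctProb p (n + 1) ≤ distinctProb p n * (1 - n / Fintype.card ι) := by
      rw [distinctProb_succ hp1, mul_sub, mul_one, mul_div_assoc', mul_comm (distinctProb p n)]
      exact sub_le_sub_left ((div_le_iff₀' hc).mpr (mul_distinctProb_le hp hp1 n)) _
    calc distinctProb p (n + 1) ≤ distinctProb p n * (1 - n / Fintype.card ι) := h1
      _ ≤ distinctProb p n * Real.exp (-(n / Fintype.card ι)) :=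
          mul_le_mul_of_nonneg_left (Real.one_sub_le_exp_neg _) (distinctProb_nonneg hp n)
      _ ≤ Real.exp (-((n : ℝ) * (n - 1) / (2 * Fintype.card ι)))
          * Real.exp (-(n / Fintype.card ι)) :=
          mul_le_mul_of_nonneg_right ih (Real.exp_pos _).le
      _ = _ := by
          rw [← Real.exp_add]
          congr 1
          push_cast
          field_simp
          ring

/-- The probability that `n` i.i.d. draws have distinct labels is at most the birthday bound. -/
theorem measure_injective_comp_le {Z ι : Type*} [MeasurableSpace Z] [Fintype ι] [Nonempty ι]
    [MeasurableSpace ι] [MeasurableSingletonClass ι] (P : Measure Z) [IsProbabilityMeasure P]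
    {φ : Z → ι} (hφ : Measurable φ) (n : ℕ) :
    Measure.pi (fun _ : Fin n => P) {D | Function.Injective fun i => φ (D i)} ≤
      ENNReal.ofReal (Real.exp (-((n : ℝ) * (n - 1) / (2 * Fintype.card ι)))) := by
  classical
  have hsub : {D : Fin n → Z | Function.Injective fun i => φ (D i)} ⊆
      ⋃ e : Fin n ↪ ι, Set.univ.pi fun i => φ ⁻¹' {e i} := fun D hD =>
    Set.mem_iUnion.mpr ⟨⟨_, hD⟩, fun i _ => rfl⟩
  have hp1 : ∑ i, P.real (φ ⁻¹' {i}) = 1 := by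
    rw [sum_measureReal_preimage_singleton _ fun i _ => hφ (measurableSet_singleton i)]
    simp
  refine (measure_mono hsub).trans <| (measure_iUnion_le _).trans ?_
  rw [tsum_fintype]
  refine le_trans (le_of_eq ?_)
    (ENNReal.ofReal_le_ofReal (distinctProb_le_exp (fun _ => measureReal_nonneg) hp1 n))
  rw [distinctProb, ENNReal.ofReal_sum_of_nonneg
    fun _ _ => Finset.prod_nonneg fun _ _ => measureReal_nonneg]
  refine Finset.sum_congr rfl fun e _ => ?_
  rw [Measure.pi_pi, ENNReal.ofReal_prod_of_nonneg fun _ _ => measureReal_nonneg]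
  simp

theorem exists_measurable_nearest {s : Finset ℝ} (hs : s.Nonempty) :
    ∃ g : ℝ → ℝ, Measurable g ∧ (∀ y, g y ∈ s) ∧ ∀ y, ∀ a ∈ s, (g y - y) ^ 2 ≤ (a - y) ^ 2 := by
  classical
  induction hs using Finset.Nonempty.cons_induction with
  | singleton a => exact ⟨fun _ => a, measurable_const, by simp, by simp⟩
  | cons a s ha hs ih =>
    obtain ⟨g, hg, hgs, hgle⟩ := ih
    refine ⟨fun y => if (a - y) ^ 2 ≤ (g y - y) ^ 2 then a else g y,
      Measurable.ite (measurableSet_le (by fun_prop) (by fun_prop)) measurable_const hg,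
      fun y => ?_, fun y b hb => ?_⟩
    · dsimp only
      split_ifs
      · simp
      · simp [hgs y]
    · have hb' := Finset.mem_cons.mp hb
      dsimp only
      split_ifs with h
      · rcases hb' with rfl | hb'
        · rfl
        · exact h.trans (hgle y b hb')
      · rcases hb' with rfl | hb'
        · exact (not_le.mp h).le
        · exact hgle y b hb'

theorem countable_setOf_measure_singleton_ne_zero {X : Type*} [MeasurableSpace X]
    [MeasurableSingletonClass X] (ν : Measure X) [SFinite ν] : {x | ν {x} ≠ 0}.Countable := by
  simpa only [pos_iff_ne_zero] using
    Measure.countable_meas_pos_of_disjoint_iUnion (μ := ν) (As := fun x : X => {x})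
      (fun x => measurableSet_singleton x)
      fun x y h => Set.disjoint_singleton.mpr h

/-- Two independent draws from `ν` do not coincide outside the atoms of `ν`. -/
theorem ae_prod_eq_imp_atom {X : Type*} [MeasurableSpace X] [MeasurableSingletonClass X]
    [MeasurableEq X] (ν : Measure X) [SFinite ν] :
    ∀ᵐ x ∂ν.prod ν, x.1 = x.2 → ν {x.1} ≠ 0 := by
  have hC : MeasurableSet {x | ν {x} ≠ 0} :=
    (countable_setOf_measure_singleton_ne_zero ν).measurableSet
  have hm : MeasurableSet {x : X × X | x.1 = x.2 ∧ ν {x.1} = 0} := by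
    refine (measurableSet_eq_fun measurable_fst measurable_snd).inter ?_
    have hC0 : MeasurableSet {x | ν {x} = 0} := by
      convert hC.compl using 1
      ext
      simp
    exact (measurable_fst : Measurable (Prod.fst : X × X → X)) hC0
  rw [ae_iff]
  have : {a : X × X | ¬(a.1 = a.2 → ν {a.1} ≠ 0)} =
      {x : X × X | x.1 = x.2 ∧ ν {x.1} = 0} := by
    ext; simp
  rw [this, Measure.measure_prod_null hm]
  refine Filter.Eventually.of_forall fun x => ?_
  by_cases hx : ν {x} = 0
  · exact measure_mono_null (fun y hy => hy.1.symm) hx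
  · simp [Set.preimage, hx]

theorem ae_pi_eq_imp_atom {X Y : Type*} [MeasurableSpace X] [MeasurableSingletonClass X]
    [MeasurableEq X] [MeasurableSpace Y] (P : Measure (X × Y)) [IsProbabilityMeasure P] (n : ℕ) :
    ∀ᵐ D ∂Measure.pi (fun _ : Fin n => P), ∀ i j, i ≠ j → (D i).1 = (D j).1 →
      P.map Prod.fst {(D i).1} ≠ 0 := by
  simp only [ae_all_iff]
  intro i j hij
  have hind := (ProbabilityTheory.iIndepFun_pi (μ := fun _ : Fin n => P)
    (X := fun _ => Prod.fst) fun _ => measurable_fst.aemeasurable).indepFun hij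
  have hmap : ∀ k : Fin n, (Measure.pi fun _ : Fin n => P).map (fun D => (D k).1)
      = P.map Prod.fst := fun k => by
    have h := (measurePreserving_eval (fun _ : Fin n => P) k).map_eq
    rw [← h, Measure.map_map measurable_fst (measurable_pi_apply k), h]
    rfl
  have hm : ∀ k : Fin n, Measurable fun D : Fin n → X × Y => (D k).1 := fun k => by fun_prop
  rw [ProbabilityTheory.indepFun_iff_map_prod_eq_prod_map_map (hm i).aemeasurable
    (hm j).aemeasurable, hmap, hmap] at hind
  have h := ae_prod_eq_imp_atom (P.map Prod.fst)
  rw [← hind] at h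
  exact ae_of_ae_map ((hm i).prodMk (hm j)).aemeasurable h

/-- A piecewise constant predictor is dominated by a measurable labelling of `ℝ^d × ℝ` with the
same values, which depends on the covariate alone at the atoms of the covariate distribution. -/
theorem exists_measurable_labelling {X : Type*} [MeasurableSpace X] [MeasurableSingletonClass X]
    (ν : Measure X) [SFinite ν] (f : X → ℝ) {s : Finset ℝ} (hs : s.Nonempty)
    (hf : ∀ x, f x ∈ s) :
    ∃ φ : X × ℝ → ℝ, Measurable φ ∧ (∀ z, φ z ∈ s) ∧
      (∀ z, (φ z - z.2) ^ 2 ≤ (f z.1 - z.2) ^ 2) ∧ ∀ z, ν {z.1} ≠ 0 → φ z = f z.1 := by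
  classical
  obtain ⟨g, hg, hgs, hgle⟩ := exists_measurable_nearest hs
  have hC := countable_setOf_measure_singleton_ne_zero ν
  set C : Set X := {x | ν {x} ≠ 0}
  have hfC : Measurable (C.indicator f) :=
    measurable_const.measurable_of_countable_ne (f := fun _ => (0 : ℝ))
      (hC.mono fun x hx => by
        by_contra h
        exact hx (Set.indicator_of_notMem h f).symm)
  refine ⟨fun z => if z.1 ∈ C then C.indicator f z.1 else g z.2,
    Measurable.ite (measurable_fst hC.measurableSet) (hfC.comp measurable_fst)
      (hg.comp measurable_snd), fun z => ?_, fun z => ?_, fun z hz => ?_⟩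
  · dsimp only
    split_ifs with h
    · rw [Set.indicator_of_mem h]
      exact hf _
    · exact hgs _
  · dsimp only
    split_ifs with h
    · rw [Set.indicator_of_mem h]
    · exact hgle _ _ (hf _)
  · have h : z.1 ∈ C := hz
    simp only [if_pos h, Set.indicator_of_mem h]

/-- If the labels of the `n` data points are a function of the covariates and collide, then they
are fitted by a function with at most `n - 1` values. -/
theorem pwcEmpClassRisk_le_of_not_injective {d n : ℕ} {D : Fin n → (Fin d → ℝ) × ℝ} {v : Fin n → ℝ}
    (hv : ∀ i j, (D i).1 = (D j).1 → v i = v j) (hinj : ¬ Function.Injective v) :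
    pwcEmpClassRisk d (n - 1) n D ≤ (∑ i, ENNReal.ofReal ((v i - (D i).2) ^ 2)) / n := by
  classical
  obtain ⟨i₀, -⟩ : ∃ i₀ : Fin n, True := by
    by_contra! h
    exact hinj fun i => (h i).elim
  set F : (Fin d → ℝ) → ℝ := Function.extend (fun i => (D i).1) v fun _ => v i₀
  have hF : F ∈ Fpwc d (n - 1) := by
    refine ⟨Finset.univ.image v, ?_, fun x => ?_⟩
    · have hlt : (Finset.univ.image v).card < n := by
        refine lt_of_le_of_ne (Finset.card_image_le.trans (by simp)) fun h => hinj ?_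
        have := Finset.card_image_iff.mp (h.trans (Finset.card_fin n).symm)
        simpa [Set.injOn_univ] using this
      omega
    · by_cases hx : ∃ i, (D i).1 = x
      · simp [F, Function.extend_def, hx]
      · simp [F, hx]
  have hFD : ∀ i, F (D i).1 = v i := fun i =>
    Function.FactorsThrough.extend_apply (f := fun i => (D i).1) (fun i j h => hv i j h) _ i
  refine (iInf₂_le F hF).trans (le_of_eq ?_)
  simp only [hFD]

theorem lintegral_pi_average {Z : Type*} [MeasurableSpace Z] (P : Measure Z)
    [IsProbabilityMeasure P] {h : Z → ℝ≥0∞} (hh : Measurable h) {n : ℕ} (hn : 1 ≤ n) :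
    ∫⁻ D, (∑ i, h (D i)) / n ∂Measure.pi (fun _ : Fin n => P) = ∫⁻ z, h z ∂P := by
  simp only [div_eq_mul_inv]
  rw [lintegral_mul_const _ (by fun_prop), lintegral_finsetSum _ (fun i _ => by fun_prop)]
  simp only [(measurePreserving_eval (fun _ : Fin n => P) _).lintegral_comp hh]
  rw [Finset.sum_const, Finset.card_univ, Fintype.card_fin, nsmul_eq_mul, mul_comm, ← mul_assoc,
    ENNReal.inv_mul_cancel (by exact_mod_cast (by omega : n ≠ 0)) (ENNReal.natCast_ne_top n),
    one_mul]

/-- The empirical lower bound exceeds a level above the model class risk with probability at most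
`α₀ + α₁`. -/
theorem measure_lt_pwcEmpClassRisk_le {d n m : ℕ} {α₀ α₁ : ℝ} (hα₀ : 0 < α₀) (hα₀1 : α₀ < 1)
    (hα₁ : 0 < α₁) (hn : 1 ≤ n)
    (hmn : (m : ℝ) ≤ (n : ℝ) * ((n : ℝ) - 1) / (2 * Real.log (1 / α₀)))
    (P : Measure ((Fin d → ℝ) × ℝ)) [IsProbabilityMeasure P] {r : ℝ≥0∞}
    (hr : pwcClassRisk d m P < r) :
    Measure.pi (fun _ : Fin n => P) {D | r < ENNReal.ofReal α₁ * pwcEmpClassRisk d (n - 1) n D} ≤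
      ENNReal.ofReal (α₀ + α₁) := by
  classical
  rcases eq_or_ne r ⊤ with rfl | hrtop
  · simp
  obtain ⟨f, ⟨s, hsm, hfs⟩, hfr⟩ : ∃ f ∈ Fpwc d m,
      ∫⁻ z, ENNReal.ofReal ((f z.1 - z.2) ^ 2) ∂P < r := by
    simpa only [pwcClassRisk, iInf_lt_iff, exists_prop] using hr
  have hs : s.Nonempty := ⟨_, hfs 0⟩
  obtain ⟨φ, hφ, hφs, hφle, hφC⟩ := exists_measurable_labelling (P.map Prod.fst) f hs hfs
  set μ := Measure.pi fun _ : Fin n => P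
  set A : (Fin n → (Fin d → ℝ) × ℝ) → ℝ≥0∞ := fun D =>
    (∑ i, ENNReal.ofReal ((φ (D i) - (D i).2) ^ 2)) / n with hA
  have hloss : Measurable fun z : (Fin d → ℝ) × ℝ => ENNReal.ofReal ((φ z - z.2) ^ 2) := by
    fun_prop
  have hAm : Measurable A := by fun_prop
  have hinj : μ {D | Function.Injective fun i => φ (D i)} ≤ ENNReal.ofReal α₀ := by
    have : Nonempty s := hs.to_subtype
    have h := measure_injective_comp_le P (φ := fun z => (⟨φ z, hφs z⟩ : s))
      (hφ.subtype_mk) n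
    simp only [Function.Injective, Subtype.mk.injEq] at h
    refine h.trans (ENNReal.ofReal_le_ofReal ?_)
    have hs0 : (0 : ℝ) < s.card := by exact_mod_cast hs.card_pos
    have hsm' : (s.card : ℝ) ≤ m := by exact_mod_cast hsm
    have hlog : 0 < Real.log (1 / α₀) := Real.log_pos (by rw [lt_div_iff₀ hα₀]; linarith)
    rw [Fintype.card_coe, ← Real.le_log_iff_exp_le hα₀]
    have h1 := (le_div_iff₀ (by positivity)).mp (hsm'.trans hmn)
    rw [one_div, Real.log_inv] at h1
    rw [neg_le, le_div_iff₀ (by positivity)]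
    linarith
  have hmarkov : μ {D | r ≤ ENNReal.ofReal α₁ * A D} ≤ ENNReal.ofReal α₁ := by
    have h := mul_meas_ge_le_lintegral₀ (μ := μ) (hAm.const_mul (ENNReal.ofReal α₁)).aemeasurable r
    rw [lintegral_const_mul _ hAm, lintegral_pi_average P hloss hn] at h
    have hle : ∫⁻ z, ENNReal.ofReal ((φ z - z.2) ^ 2) ∂P ≤ r :=
      (lintegral_mono fun z => ENNReal.ofReal_le_ofReal (hφle z)).trans hfr.le
    have h2 := h.trans (mul_le_mul_right hle _)
    rw [mul_comm] at h2
    exact (ENNReal.mul_le_mul_iff_left (pos_of_gt hr).ne' hrtop).mp h2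
  have hae := ae_pi_eq_imp_atom P n
  refine (measure_mono_ae (t := {D | Function.Injective fun i => φ (D i)} ∪
    {D | r ≤ ENNReal.ofReal α₁ * A D}) ?_).trans <| (measure_union_le _ _).trans ?_
  · filter_upwards [hae] with D hD hrD
    by_contra hcon
    obtain ⟨h1, h2⟩ := not_or.mp hcon
    refine h2 (le_of_lt (lt_of_lt_of_le hrD (mul_le_mul_right ?_ _)))
    refine pwcEmpClassRisk_le_of_not_injective (fun i j hij => ?_) h1
    rcases eq_or_ne i j with rfl | hne
    · rfl
    · rw [hφC _ (hD i j hne hij), hφC _ (hD j i hne.symm hij.symm), hij]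
  · rw [ENNReal.ofReal_add hα₀.le hα₁.le]
    exact add_le_add hinj hmarkov

/-- For `m ≤ n(n-1)/(2 log(1/α₀))`, the quantity
`α₁ · R̂(F_pwc^(n-1), D_n)` is a valid distribution-free lower bound on the model class
risk `R_P(F_pwc^(m))`. -/
theorem pwc_lower_bound_valid
    (d : ℕ) (α α₀ α₁ : ℝ) (hα : α ∈ Set.Ioo (0 : ℝ) 1)
    (hα₀ : 0 < α₀) (hα₁ : 0 < α₁) (hsum : α₀ + α₁ = α)
    (n m : ℕ) (hn : 1 ≤ n) (hm : 1 ≤ m)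
    (hmn : (m : ℝ) ≤ (n : ℝ) * ((n : ℝ) - 1) / (2 * Real.log (1 / α₀)))
    (P : Measure ((Fin d → ℝ) × ℝ)) [IsProbabilityMeasure P] :
    ENNReal.ofReal (1 - α) ≤
      Measure.pi (fun _ : Fin n => P)
        {D | ENNReal.ofReal α₁ * pwcEmpClassRisk d (n - 1) n D ≤ pwcClassRisk d m P} := by
  set μ := Measure.pi fun _ : Fin n => P
  set S := {D | ENNReal.ofReal α₁ * pwcEmpClassRisk d (n - 1) n D ≤ pwcClassRisk d m P}
  have hcompl : μ Sᶜ ≤ ENNReal.ofReal α := by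
    rcases eq_or_ne (pwcClassRisk d m P) ⊤ with htop | htop
    · have : Sᶜ = ∅ := by simp [S, htop]
      simp [this]
    obtain ⟨u, hu, hur, hulim⟩ := exists_seq_strictAnti_tendsto' (lt_top_iff_ne_top.mpr htop)
    have hS : Sᶜ = ⋃ k, {D | u k < ENNReal.ofReal α₁ * pwcEmpClassRisk d (n - 1) n D} := by
      ext D
      simp only [S, Set.mem_compl_iff, Set.mem_ofPred_eq, not_le, Set.mem_iUnion]
      exact ⟨fun h => (hulim.eventually_lt_const h).exists, fun ⟨k, hk⟩ => (hur k).1.trans hk⟩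
    have hmono : Monotone fun k =>
        {D | u k < ENNReal.ofReal α₁ * pwcEmpClassRisk d (n - 1) n D} :=
      fun k l hkl D hD => (hu.antitone hkl).trans_lt hD
    rw [hS, hmono.measure_iUnion, ← hsum]
    exact iSup_le fun k => measure_lt_pwcEmpClassRisk_le hα₀ (by linarith [hα.2]) hα₁ hn hmn P
      (hur k).1
  rw [ENNReal.ofReal_sub _ hα.1.le, ENNReal.ofReal_one, tsub_le_iff_right]
  calc (1 : ℝ≥0∞) = μ (S ∪ Sᶜ) := by rw [Set.union_compl_self, measure_univ]
    _ ≤ μ S + μ Sᶜ := measure_union_le _ _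
    _ ≤ μ S + ENNReal.ofReal α := by gcongr
end

section
/- Consider a discrete distribution P_Y with support {y_1, …, y_m} (m distinct points), and let Y_1, …, Y_n be i.i.d. from P_Y. Let I = ∑_{j=1}^m 1{ ∑_{i=1}^n 1{Y_i = y_j} > 0 } denote the number of unique values observed in the sample. Then for any α_0 ∈ (0,1), P( I ≤ n − r ) ≥ 1 − α_0, where r = ⌈( n(n−1)/(n+2m) − 2√( n(n−1)/(n+2m) · log(1/α_0) ) )_+⌉. -/
open MeasureTheory
open scoped ENNReal NNReal BigOperators

/-- The generating function `E[z ^ I]` of the number `I` of distinct values among `n` draws with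
weights `p`. -/
noncomputable def distinctGenFun {ι : Type*} [Fintype ι] [DecidableEq ι] (p : ι → ℝ) (n : ℕ)
    (z : ℝ) : ℝ :=
  ∑ D : Fin n → ι, (∏ i, p (D i)) * z ^ (Finset.image D Finset.univ).card

theorem pow_card_image_eq_sum {ι κ : Type*} [Fintype ι] [DecidableEq ι] [Fintype κ]
    (D : κ → ι) (z : ℝ) :
    z ^ (Finset.image D Finset.univ).card =
      ∑ U : Finset ι, z ^ U.card * (1 - z) ^ Uᶜ.card * ∏ i, if D i ∈ U then (1 : ℝ) else 0 := by
  have h := Fintype.prod_add (fun _ : ι => z)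
    (fun j => if j ∈ Finset.image D Finset.univ then 0 else 1 - z)
  have h1 : ∏ j : ι, (z + if j ∈ Finset.image D Finset.univ then 0 else 1 - z) =
      z ^ (Finset.image D Finset.univ).card := by
    rw [Finset.prod_congr rfl (g := fun j => if j ∈ Finset.image D Finset.univ then z else 1)]
    · rw [Finset.prod_ite_mem, Finset.univ_inter, Finset.prod_const]
    · intro j _
      split_ifs <;> ring
  rw [← h1, h]
  refine Finset.sum_congr rfl fun U _ => ?_
  rw [Finset.prod_const, mul_assoc]
  congr 1
  by_cases hU : ∀ i, D i ∈ U
  · rw [Finset.prod_congr rfl (g := fun _ => 1 - z)]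
    · simp [hU]
    · intro j hj
      rw [if_neg]
      rintro hj'
      obtain ⟨i, -, rfl⟩ := Finset.mem_image.1 hj'
      exact (Finset.mem_compl.1 hj) (hU i)
  · push Not at hU
    obtain ⟨i, hi⟩ := hU
    rw [Finset.prod_eq_zero (i := D i) (by simpa using hi) (by simp),
      Finset.prod_eq_zero (i := i) (Finset.mem_univ i) (by simp [hi]), mul_zero]

theorem distinctGenFun_eq_sum {ι : Type*} [Fintype ι] [DecidableEq ι] (p : ι → ℝ) (n : ℕ)
    (z : ℝ) :
    distinctGenFun p n z =
      ∑ U : Finset ι, z ^ U.card * (1 - z) ^ Uᶜ.card * (∑ j ∈ U, p j) ^ n := by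
  simp only [distinctGenFun, pow_card_image_eq_sum, Finset.mul_sum]
  rw [Finset.sum_comm]
  refine Finset.sum_congr rfl fun U _ => ?_
  have : ∑ j ∈ U, p j = ∑ j, p j * if j ∈ U then (1 : ℝ) else 0 := by simp
  rw [this, Fintype.sum_pow, Finset.mul_sum]
  refine Finset.sum_congr rfl fun D _ => ?_
  rw [Finset.prod_mul_distrib]
  ring

/-- The exponential generating function `1 + z (e ^ (a X) - 1)` of one cell of mass `a`. -/
noncomputable def cellSeries (z a : ℝ) : PowerSeries ℝ :=
  PowerSeries.C z * PowerSeries.rescale a (PowerSeries.exp ℝ) + PowerSeries.C (1 - z)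

theorem prod_rescale_exp {ι : Type*} (p : ι → ℝ) (U : Finset ι) :
    ∏ j ∈ U, PowerSeries.rescale (p j) (PowerSeries.exp ℝ) =
      PowerSeries.rescale (∑ j ∈ U, p j) (PowerSeries.exp ℝ) := by
  classical
  induction U using Finset.induction_on with
  | empty => simp [PowerSeries.rescale_zero]
  | insert a s ha ih =>
    rw [Finset.prod_insert ha, Finset.sum_insert ha, ih, PowerSeries.exp_mul_exp_eq_exp_add]

theorem coeff_rescale_exp (a : ℝ) (n : ℕ) :
    PowerSeries.coeff n (PowerSeries.rescale a (PowerSeries.exp ℝ)) = a ^ n / n.factorial := by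
  rw [PowerSeries.coeff_rescale, PowerSeries.coeff_exp]
  simp [div_eq_mul_inv]

theorem distinctGenFun_eq_coeff {ι : Type*} [Fintype ι] [DecidableEq ι] (p : ι → ℝ) (n : ℕ)
    (z : ℝ) :
    distinctGenFun p n z =
      n.factorial * PowerSeries.coeff n (∏ j, cellSeries z (p j)) := by
  have hn : (n.factorial : ℝ) ≠ 0 := by exact_mod_cast n.factorial_ne_zero
  simp only [cellSeries]
  rw [Fintype.prod_add, map_sum, distinctGenFun_eq_sum, Finset.mul_sum]
  refine Finset.sum_congr rfl fun U _ => ?_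
  rw [Finset.prod_mul_distrib, prod_rescale_exp, Finset.prod_const, Finset.prod_const, ← map_pow,
    ← map_pow, mul_comm _ (PowerSeries.C ((1 - z) ^ _)),
    PowerSeries.coeff_C_mul, PowerSeries.coeff_C_mul, coeff_rescale_exp]
  field_simp

theorem coeff_cellSeries_nonneg {z a : ℝ} (hz : 1 ≤ z) (ha : 0 ≤ a) (n : ℕ) :
    0 ≤ PowerSeries.coeff n (cellSeries z a) := by
  rw [cellSeries, map_add, PowerSeries.coeff_C_mul, coeff_rescale_exp, PowerSeries.coeff_C]
  split_ifs with h
  · subst h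
    simp
  · have : 0 ≤ a ^ n / n.factorial := by positivity
    nlinarith

theorem PowerSeries.coeff_mul_nonneg {f g : PowerSeries ℝ}
    (hf : ∀ n, 0 ≤ PowerSeries.coeff n f) (hg : ∀ n, 0 ≤ PowerSeries.coeff n g) (n : ℕ) :
    0 ≤ PowerSeries.coeff n (f * g) := by
  rw [PowerSeries.coeff_mul]
  exact Finset.sum_nonneg fun x _ => mul_nonneg (hf _) (hg _)

theorem PowerSeries.coeff_prod_nonneg {ι : Type*} (s : Finset ι) {f : ι → PowerSeries ℝ}
    (hf : ∀ i ∈ s, ∀ n, 0 ≤ PowerSeries.coeff n (f i)) :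
    ∀ n, 0 ≤ PowerSeries.coeff n (∏ i ∈ s, f i) := by
  refine Finset.prod_induction f (fun g => ∀ n, 0 ≤ PowerSeries.coeff n g)
    (fun _ _ => PowerSeries.coeff_mul_nonneg) (fun n => ?_) hf
  rw [PowerSeries.coeff_one]
  split_ifs <;> norm_num

theorem pow_add_pow_le_of_mem_Icc {a b c : ℝ} (ha : 0 ≤ a) (hac : a ≤ c) (hcb : c ≤ b) (k : ℕ) :
    c ^ k + (a + b - c) ^ k ≤ a ^ k + b ^ k := by
  rcases (hac.trans hcb).eq_or_lt with hab | hab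
  · obtain rfl : c = a := le_antisymm (hab ▸ hcb) hac
    simp
  have hd : 0 < b - a := sub_pos.2 hab
  set s := (b - c) / (b - a)
  set t := (c - a) / (b - a)
  have hs : 0 ≤ s := div_nonneg (sub_nonneg.2 hcb) hd.le
  have ht : 0 ≤ t := div_nonneg (sub_nonneg.2 hac) hd.le
  have hst : s + t = 1 := by
    simp only [s, t]
    field_simp
    ring
  have h1 : s * a + t * b = c := by
    simp only [s, t]
    field_simp
    ring
  have h2 : t * a + s * b = a + b - c := by
    linear_combination (a + b) * hst - h1
  have hb : 0 ≤ b := ha.trans hab.le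
  have e1 := (convexOn_pow (𝕜 := ℝ) k).2 (x := a) ha (y := b) hb hs ht hst
  have e2 := (convexOn_pow (𝕜 := ℝ) k).2 (x := a) ha (y := b) hb ht hs (by rw [add_comm, hst])
  simp only [smul_eq_mul, h1, h2] at e1 e2
  calc c ^ k + (a + b - c) ^ k ≤ (s + t) * (a ^ k + b ^ k) := by linarith
    _ = _ := by rw [hst, one_mul]

theorem coeff_cellSeries_mul (z a b : ℝ) (n : ℕ) :
    PowerSeries.coeff n (cellSeries z a * cellSeries z b) =
      z ^ 2 * ((a + b) ^ n / n.factorial) - z * (z - 1) * ((a ^ n + b ^ n) / n.factorial)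
        + PowerSeries.coeff n (PowerSeries.C ((1 - z) ^ 2)) := by
  have : cellSeries z a * cellSeries z b =
      PowerSeries.C (z ^ 2) * PowerSeries.rescale (a + b) (PowerSeries.exp ℝ)
      + PowerSeries.C (z * (1 - z)) * PowerSeries.rescale a (PowerSeries.exp ℝ)
      + PowerSeries.C (z * (1 - z)) * PowerSeries.rescale b (PowerSeries.exp ℝ)
      + PowerSeries.C ((1 - z) ^ 2) := by
    rw [← PowerSeries.exp_mul_exp_eq_exp_add, cellSeries, cellSeries]
    simp only [map_mul, map_pow]
    ring
  rw [this]
  simp only [map_add, PowerSeries.coeff_C_mul, coeff_rescale_exp]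
  ring

theorem coeff_cellSeries_mul_le {z a b c : ℝ} (hz : 1 ≤ z) (ha : 0 ≤ a) (hac : a ≤ c)
    (hcb : c ≤ b) (n : ℕ) :
    PowerSeries.coeff n (cellSeries z a * cellSeries z b) ≤
      PowerSeries.coeff n (cellSeries z c * cellSeries z (a + b - c)) := by
  rw [coeff_cellSeries_mul, coeff_cellSeries_mul, add_sub_cancel]
  have h := pow_add_pow_le_of_mem_Icc ha hac hcb n
  have hz' : 0 ≤ z * (z - 1) := by nlinarith
  gcongr

/-- Moving one of two masses to an intermediate value, while keeping their sum, increases the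
generating function. -/
theorem distinctGenFun_le_update {ι : Type*} [Fintype ι] [DecidableEq ι] {p : ι → ℝ}
    (hp : ∀ j, 0 ≤ p j) {i j : ι} (hij : i ≠ j) {c : ℝ} (hic : p i ≤ c) (hcj : c ≤ p j)
    {z : ℝ} (hz : 1 ≤ z) (n : ℕ) :
    distinctGenFun p n z ≤
      distinctGenFun (Function.update (Function.update p i c) j (p i + p j - c)) n z := by
  set p' := Function.update (Function.update p i c) j (p i + p j - c) with hp'
  have hj : j ∈ Finset.univ.erase i := by simp [hij.symm]
  have key : ∀ q : ι → ℝ, ∏ k, cellSeries z (q k) =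
      (cellSeries z (q i) * cellSeries z (q j)) *
        ∏ k ∈ (Finset.univ.erase i).erase j, cellSeries z (q k) := fun q => by
    rw [mul_assoc, Finset.mul_prod_erase _ (fun k => cellSeries z (q k)) hj,
      Finset.mul_prod_erase _ (fun k => cellSeries z (q k)) (Finset.mem_univ i)]
  have hrest : ∏ k ∈ (Finset.univ.erase i).erase j, cellSeries z (p' k) =
      ∏ k ∈ (Finset.univ.erase i).erase j, cellSeries z (p k) := by
    refine Finset.prod_congr rfl fun k hk => ?_
    simp only [Finset.mem_erase] at hk
    rw [hp', Function.update_of_ne hk.1, Function.update_of_ne hk.2.1]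
  have hi' : p' i = c := by simp [hp', Function.update_of_ne hij]
  have hj' : p' j = p i + p j - c := by simp [hp']
  rw [distinctGenFun_eq_coeff, distinctGenFun_eq_coeff, key p, key p', hrest, hi', hj',
    PowerSeries.coeff_mul, PowerSeries.coeff_mul]
  gcongr with x hx
  · exact PowerSeries.coeff_prod_nonneg _ (fun k _ => coeff_cellSeries_nonneg hz (hp k)) _
  · exact coeff_cellSeries_mul_le hz (hp i) hic hcj _

theorem exists_lt_of_sum_eq_of_ne {ι : Type*} [Fintype ι] {p q : ι → ℝ}
    (h : ∑ j, p j = ∑ j, q j) (hne : ∃ j, p j ≠ q j) : ∃ i, p i < q i := by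
  by_contra! hle
  obtain ⟨j, hj⟩ := hne
  exact h.not_gt (Finset.sum_lt_sum (fun i _ => hle i) ⟨j, Finset.mem_univ j,
    lt_of_le_of_ne (hle j) hj.symm⟩)

/-- The uniform distribution maximizes the generating function of the number of distinct
values. -/
theorem distinctGenFun_le_uniform {ι : Type*} [Fintype ι] [DecidableEq ι] {z : ℝ} (hz : 1 ≤ z)
    (n : ℕ) {c : ℝ} (p : ι → ℝ) (hp : ∀ j, 0 ≤ p j) (hsum : ∑ j, p j = ∑ _j : ι, c) :
    distinctGenFun p n z ≤ distinctGenFun (fun _ : ι => c) n z := by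
  induction hN : (Finset.univ.filter fun j => p j ≠ c).card using Nat.strong_induction_on
    generalizing p with
  | _ N ih =>
    by_cases hne : ∃ j, p j ≠ c
    · obtain ⟨i, hi⟩ := exists_lt_of_sum_eq_of_ne hsum hne
      obtain ⟨j, hj⟩ := exists_lt_of_sum_eq_of_ne hsum.symm
        (hne.imp fun _ h => h.symm)
      have hij : i ≠ j := by
        rintro rfl
        exact lt_asymm hi hj
      refine (distinctGenFun_le_update hp hij hi.le hj.le hz n).trans (ih _ ?_ _ ?_ ?_ rfl)
      · rw [← hN]
        refine Finset.card_lt_card (Finset.ssubset_iff_subset_ne.2 ⟨fun k hk => ?_, fun h => ?_⟩)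
        · simp only [Finset.mem_filter, Finset.mem_univ, true_and] at hk ⊢
          rcases eq_or_ne k j with rfl | hkj
          · exact hj.ne'
          rcases eq_or_ne k i with rfl | hki
          · exact hi.ne
          rwa [Function.update_of_ne hkj, Function.update_of_ne hki] at hk
        · have : i ∈ Finset.univ.filter fun k => p k ≠ c := by simp [hi.ne]
          rw [← h] at this
          simp [Function.update_of_ne hij] at this
      · intro k
        rcases eq_or_ne k j with rfl | hkj
        · rw [Function.update_self]
          linarith [hp i]
        rcases eq_or_ne k i with rfl | hki
        · rw [Function.update_of_ne hij, Function.update_self]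
          linarith [hp k]
        rw [Function.update_of_ne hkj, Function.update_of_ne hki]
        exact hp k
      · rw [← hsum, Finset.sum_update_of_mem (Finset.mem_univ j),
          Finset.sum_update_of_mem (by simp [hij]),
          ← Finset.add_sum_erase _ _ (Finset.mem_univ j),
          ← Finset.add_sum_erase (Finset.univ.erase j) _ (Finset.mem_erase.2
            ⟨hij, Finset.mem_univ i⟩)]
        simp only [Finset.sdiff_singleton_eq_erase]
        ring
    · push Not at hne
      obtain rfl : p = fun _ => c := funext hne
      rfl

theorem sum_card_image_succ {ι : Type*} [Fintype ι] [DecidableEq ι] (n : ℕ) (φ : ℕ → ℝ) :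
    ∑ D : Fin (n + 1) → ι, φ (Finset.image D Finset.univ).card =
      ∑ D : Fin n → ι, ((Finset.image D Finset.univ).card * φ (Finset.image D Finset.univ).card +
        (Fintype.card ι - (Finset.image D Finset.univ).card) *
          φ ((Finset.image D Finset.univ).card + 1)) := by
  rw [← (Fin.consEquiv fun _ : Fin (n + 1) => ι).sum_comp, Fintype.sum_prod_type_right]
  refine Finset.sum_congr rfl fun D _ => ?_
  have himg : ∀ j : ι, Finset.image (Fin.consEquiv (fun _ : Fin (n + 1) => ι) (j, D)) Finset.univ =
      insert j (Finset.image D Finset.univ) := by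
    intro j
    ext x
    simp [Fin.consEquiv, Fin.exists_fin_succ, eq_comm]
  simp only [himg]
  set S := Finset.image D Finset.univ
  rw [← Finset.sum_add_sum_compl S]
  congr 1
  · rw [Finset.sum_congr rfl (g := fun _ => φ S.card), Finset.sum_const, nsmul_eq_mul]
    intro j hj
    rw [Finset.insert_eq_of_mem hj]
  · rw [Finset.sum_congr rfl (g := fun _ => φ (S.card + 1)), Finset.sum_const, nsmul_eq_mul,
      Finset.card_compl, Nat.cast_sub (Finset.card_le_univ S)]
    intro j hj
    rw [Finset.card_insert_of_notMem (Finset.mem_compl.1 hj)]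

/-- The expected number of distinct values among `n` uniform draws from `m` points. -/
noncomputable def meanDistinct (m : ℝ) : ℕ → ℝ
  | 0 => 0
  | n + 1 => meanDistinct m n + (1 - meanDistinct m n / m)

theorem sum_card_image {ι : Type*} [Fintype ι] [DecidableEq ι] [Nonempty ι] (n : ℕ) :
    ∑ D : Fin n → ι, ((Finset.image D Finset.univ).card : ℝ) =
      (Fintype.card ι : ℝ) ^ n * meanDistinct (Fintype.card ι) n := by
  induction n with
  | zero => simp [meanDistinct]
  | succ n ih =>
    have hm : (Fintype.card ι : ℝ) ≠ 0 := by exact_mod_cast Fintype.card_ne_zero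
    rw [sum_card_image_succ n (fun k => (k : ℝ)), Finset.sum_congr rfl
      (g := fun D : Fin n → ι => ((Fintype.card ι : ℝ) - 1) * (Finset.image D Finset.univ).card
        + Fintype.card ι)]
    · rw [Finset.sum_add_distrib, ← Finset.mul_sum, ih, meanDistinct]
      simp only [Finset.sum_const, Finset.card_univ, Fintype.card_fun, Fintype.card_fin,
        nsmul_eq_mul, Nat.cast_pow]
      field_simp
      ring
    · intro D _
      push_cast
      ring

theorem meanDistinct_le {m : ℝ} (hm : 1 ≤ m) (n : ℕ) :
    meanDistinct m n ≤ n * (2 * m + 1) / (n + 2 * m) := by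
  induction n with
  | zero => simp [meanDistinct]
  | succ n ih =>
    have hn : (0 : ℝ) ≤ n := n.cast_nonneg
    have hm0 : 0 < m := by linarith
    have h1 : 0 ≤ 1 - 1 / m := by
      rw [sub_nonneg, div_le_one hm0]
      exact hm
    calc meanDistinct m (n + 1) = 1 + (1 - 1 / m) * meanDistinct m n := by
          rw [meanDistinct]
          ring
      _ ≤ 1 + (1 - 1 / m) * (n * (2 * m + 1) / (n + 2 * m)) := by gcongr
      _ ≤ _ := by
        rw [← sub_nonneg]
        have : ((n + 1 : ℕ) : ℝ) * (2 * m + 1) / ((n + 1 : ℕ) + 2 * m)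
            - (1 + (1 - 1 / m) * (n * (2 * m + 1) / (n + 2 * m))) =
            ((m + 1) * n * (n + 1 + 2 * m) - 2 * m ^ 2 * n) /
              (m * (n + 2 * m) * (n + 1 + 2 * m)) := by
          push_cast
          field_simp
          ring
        rw [this]
        apply div_nonneg
        · nlinarith [mul_nonneg hn hn, mul_nonneg hn hm0.le, mul_nonneg (mul_nonneg hn hn) hm0.le]
        · positivity

/-- Chebyshev's association inequality gives a one-step recursion for uniform draws. -/
theorem sum_pow_card_image_succ_le {ι : Type*} [Fintype ι] [DecidableEq ι] [Nonempty ι] {z : ℝ}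
    (hz : 1 ≤ z) (n : ℕ) :
    ∑ D : Fin (n + 1) → ι, z ^ (Finset.image D Finset.univ).card ≤
      Fintype.card ι * (z - (z - 1) * (meanDistinct (Fintype.card ι) n / Fintype.card ι)) *
        ∑ D : Fin n → ι, z ^ (Finset.image D Finset.univ).card := by
  have hm : (0 : ℝ) < Fintype.card ι := by exact_mod_cast Fintype.card_pos
  have hmono : Monovary (fun D : Fin n → ι => ((Finset.image D Finset.univ).card : ℝ))
      (fun D : Fin n → ι => z ^ (Finset.image D Finset.univ).card) := by
    intro D D' h
    by_contra! hlt
    exact h.not_ge (pow_le_pow_right₀ hz (by exact_mod_cast hlt.le))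
  have hcheb := hmono.sum_mul_sum_le_card_mul_sum
  rw [sum_card_image, Fintype.card_fun, Fintype.card_fin, Nat.cast_pow, mul_assoc] at hcheb
  have hcheb' := le_of_mul_le_mul_left hcheb (pow_pos hm n)
  rw [sum_card_image_succ n (fun k => z ^ k), Finset.sum_congr rfl
    (g := fun D : Fin n → ι => Fintype.card ι * z * z ^ (Finset.image D Finset.univ).card -
      (z - 1) * ((Finset.image D Finset.univ).card * z ^ (Finset.image D Finset.univ).card))
    (fun D _ => by ring), Finset.sum_sub_distrib, ← Finset.mul_sum, ← Finset.mul_sum]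
  have hz' : 0 ≤ z - 1 := by linarith
  calc _ ≤ _ := sub_le_sub_left (mul_le_mul_of_nonneg_left hcheb' hz') _
    _ = _ := by
      field_simp

theorem distinctGenFun_uniform_le {ι : Type*} [Fintype ι] [DecidableEq ι] [Nonempty ι] {z : ℝ}
    (hz : 1 ≤ z) (n : ℕ) :
    distinctGenFun (fun _ : ι => (Fintype.card ι : ℝ)⁻¹) n z ≤
      z ^ n * Real.exp (-((1 - z⁻¹) * (n - meanDistinct (Fintype.card ι) n))) := by
  have hz0 : 0 < z := by linarith
  have hm : (0 : ℝ) < Fintype.card ι := by exact_mod_cast Fintype.card_pos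
  have heq : ∀ n, distinctGenFun (fun _ : ι => (Fintype.card ι : ℝ)⁻¹) n z =
      ((Fintype.card ι : ℝ) ^ n)⁻¹ * ∑ D : Fin n → ι, z ^ (Finset.image D Finset.univ).card := by
    intro n
    simp [distinctGenFun, Finset.mul_sum]
  induction n with
  | zero => simp [distinctGenFun, meanDistinct]
  | succ n ih =>
    have hpos : 0 ≤ distinctGenFun (fun _ : ι => (Fintype.card ι : ℝ)⁻¹) n z :=
      Finset.sum_nonneg fun D _ => by positivity
    calc distinctGenFun (fun _ : ι => (Fintype.card ι : ℝ)⁻¹) (n + 1) z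
      _ ≤ ((Fintype.card ι : ℝ) ^ (n + 1))⁻¹ * (Fintype.card ι *
          (z - (z - 1) * (meanDistinct (Fintype.card ι) n / Fintype.card ι)) *
          ∑ D : Fin n → ι, z ^ (Finset.image D Finset.univ).card) := by
        rw [heq]
        gcongr
        exact sum_pow_card_image_succ_le hz n
      _ = z * (1 - (1 - z⁻¹) * (meanDistinct (Fintype.card ι) n / Fintype.card ι)) *
          distinctGenFun (fun _ : ι => (Fintype.card ι : ℝ)⁻¹) n z := by
        rw [heq]
        field_simp
        ring
      _ ≤ z * Real.exp (-((1 - z⁻¹) * (meanDistinct (Fintype.card ι) n / Fintype.card ι))) *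
          (z ^ n * Real.exp (-((1 - z⁻¹) * (n - meanDistinct (Fintype.card ι) n)))) := by
        gcongr
        exact Real.one_sub_le_exp_neg _
      _ = _ := by
        rw [mul_mul_mul_comm, ← Real.exp_add, ← pow_succ', meanDistinct]
        congr 2
        push_cast
        ring

/-- The lower tail of the number of collisions among `n` independent draws with weights `p`. -/
theorem sum_collisions_lt_le {ι : Type*} [Fintype ι] [DecidableEq ι] [Nonempty ι] {n : ℕ}
    (hn : 1 ≤ n) (p : ι → ℝ) (hp : ∀ j, 0 ≤ p j) (hsum : ∑ j, p j = 1) {L μ : ℝ} (hL : 0 ≤ L)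
    (hμ : μ = (n : ℝ) * ((n : ℝ) - 1) / ((n : ℝ) + 2 * Fintype.card ι)) :
    ∑ D : Fin n → ι with (n : ℝ) - (Finset.image D Finset.univ).card < μ - 2 * √(μ * L),
      ∏ i, p (D i) ≤ Real.exp (-L) := by
  have hm : (1 : ℝ) ≤ Fintype.card ι := by exact_mod_cast Fintype.card_pos
  have hn' : (1 : ℝ) ≤ n := by exact_mod_cast hn
  set x := μ - 2 * √(μ * L) with hx
  rcases le_or_gt x 0 with hx0 | hx0
  · rw [Finset.sum_eq_zero]
    · positivity
    · intro D hD
      have h1 := (Finset.mem_filter.1 hD).2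
      have h2 : (Finset.image D Finset.univ).card ≤ n := by
        simpa using Finset.card_image_le (s := Finset.univ) (f := D)
      have h3 : ((Finset.image D Finset.univ).card : ℝ) ≤ n := by exact_mod_cast h2
      linarith
  have hμ0 : 0 < μ := by
    have := Real.sqrt_nonneg (μ * L)
    linarith
  set t := √(μ * L) with ht
  have ht0 : 0 ≤ t := Real.sqrt_nonneg _
  have htsq : t * t = μ * L := Real.mul_self_sqrt (by positivity)
  obtain ⟨l, hl⟩ : ∃ l, l = t / μ := ⟨_, rfl⟩
  have hl0 : 0 ≤ l := hl ▸ div_nonneg ht0 hμ0.le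
  have hl1 : l ≤ 1 := by
    rw [hl, div_le_one hμ0]
    linarith
  have hlμ : l * μ = t := by
    rw [hl]
    field_simp
  have hlt : l * t = L := by
    rw [hl]
    field_simp
    linarith
  set z := Real.exp l with hz
  have hz1 : 1 ≤ z := Real.one_le_exp hl0
  have hμle : μ ≤ n - meanDistinct (Fintype.card ι) n := by
    have h := meanDistinct_le hm n
    have : (n : ℝ) * (2 * Fintype.card ι + 1) / (n + 2 * Fintype.card ι) = n - μ := by
      rw [hμ]
      field_simp
      ring
    linarith
  have hgen : distinctGenFun p n z ≤ z ^ n * Real.exp (-((l - l ^ 2) * μ)) := by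
    refine (distinctGenFun_le_uniform hz1 n (c := (Fintype.card ι : ℝ)⁻¹) p hp ?_).trans
      ((distinctGenFun_uniform_le hz1 n).trans ?_)
    · rw [hsum]
      simp
    · have h1 : l - l ^ 2 ≤ 1 - z⁻¹ := by
        have := (abs_le.1 (Real.abs_exp_sub_one_sub_id_le (x := -l)
          (by rwa [abs_neg, abs_of_nonneg hl0]))).2
        rw [hz, ← Real.exp_neg]
        linarith
      have h2 : 0 ≤ 1 - z⁻¹ := sub_nonneg.2 (inv_le_one_of_one_le₀ hz1)
      gcongr
  calc ∑ D : Fin n → ι with (n : ℝ) - (Finset.image D Finset.univ).card < x, ∏ i, p (D i)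
    _ ≤ ∑ D : Fin n → ι with (n : ℝ) - (Finset.image D Finset.univ).card < x,
        Real.exp (l * x - l * n) * ((∏ i, p (D i)) * z ^ (Finset.image D Finset.univ).card) := by
      refine Finset.sum_le_sum fun D hD => ?_
      have h1 := (Finset.mem_filter.1 hD).2
      rw [mul_left_comm, hz, ← Real.exp_nat_mul, ← Real.exp_add]
      refine le_mul_of_one_le_right (Finset.prod_nonneg fun i _ => hp _) (Real.one_le_exp ?_)
      nlinarith
    _ ≤ Real.exp (l * x - l * n) * distinctGenFun p n z := by
      rw [distinctGenFun, Finset.mul_sum]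
      refine Finset.sum_le_sum_of_subset_of_nonneg (Finset.filter_subset _ _) fun D _ _ => ?_
      have := Finset.prod_nonneg fun i (_ : i ∈ Finset.univ) => hp (D i)
      positivity
    _ ≤ Real.exp (l * x - l * n) * (z ^ n * Real.exp (-((l - l ^ 2) * μ))) := by gcongr
    _ = Real.exp (-L) := by
      rw [hz, ← Real.exp_nat_mul, ← Real.exp_add, ← Real.exp_add, hx]
      congr 1
      linear_combination (-2 : ℝ) * hlt + l * hlμ + hlt

/-- A probability measure concentrated on finitely many points, for an arbitrary `σ`-algebra, is
the image of a measure on the index set of these points. -/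
theorem exists_map_eq_of_measure_range_eq_one {A : Type*} [MeasurableSpace A] {m : ℕ}
    (y : Fin m → A) (μ : Measure A) [IsProbabilityMeasure μ] (h : μ (Set.range y) = 1) :
    ∃ ν : Measure (Fin m), ν.map y = μ := by
  have hnull : ∀ B, MeasurableSet B → (∀ k, y k ∉ B) → μ B = 0 := by
    intro B hB hy
    have h1 : μ Bᶜ = 1 := le_antisymm prob_le_one
      (h ▸ measure_mono (by rintro _ ⟨k, rfl⟩; exact hy k))
    simpa using (prob_compl_eq_zero_iff hB.compl).2 h1
  have hsep : ∀ j k, ∃ B, MeasurableSet B ∧ y j ∈ B ∧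
      (y k ∈ B → ∀ T, MeasurableSet T → (y j ∈ T ↔ y k ∈ T)) := by
    intro j k
    by_cases hjk : ∃ B, MeasurableSet B ∧ y j ∈ B ∧ y k ∉ B
    · obtain ⟨B, hB, hj, hk⟩ := hjk
      exact ⟨B, hB, hj, fun hk' => absurd hk' hk⟩
    · push Not at hjk
      refine ⟨Set.univ, .univ, trivial, fun _ T hT => ⟨hjk T hT, fun hk => ?_⟩⟩
      by_contra hj
      exact hjk Tᶜ hT.compl hj hk
  choose B hB hyB hBsep using hsep
  let C : Fin m → Set A := fun j => ⋂ k, B j k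
  have hC : ∀ j, MeasurableSet (C j) := fun j => .iInter (hB j)
  let D : Fin m → Set A := fun j => C j \ ⋃ k : Fin m, ⋃ _ : k < j, C k
  have hD : ∀ j, MeasurableSet (D j) := fun j =>
    (hC j).diff (.iUnion fun k => .iUnion fun _ => hC k)
  have hdisj : Pairwise (Function.onFun Disjoint D) := by
    have aux : ∀ i j, i < j → Disjoint (D i) (D j) := fun i j hij =>
      Set.disjoint_left.2 fun a hi hj => hj.2 (Set.mem_iUnion₂.2 ⟨i, hij, hi.1⟩)
    intro i j hij
    rcases hij.lt_or_gt with h' | h'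
    · exact aux i j h'
    · exact (aux j i h').symm
  have hcover : ∀ k, y k ∈ ⋃ j, D j := by
    intro k
    have hex : ∃ j, y k ∈ C j := ⟨k, Set.mem_iInter.2 (hyB k)⟩
    obtain ⟨j, hj, hmin⟩ := WellFounded.has_min (wellFounded_lt (α := Fin m))
      {j | y k ∈ C j} hex
    refine Set.mem_iUnion.2 ⟨j, hj, fun hlt => ?_⟩
    obtain ⟨i, hi, hki⟩ := Set.mem_iUnion₂.1 hlt
    exact hmin i hki hi
  have hy : Measurable y := measurable_of_countable y
  refine ⟨Measure.sum fun j => μ (D j) • Measure.dirac j, Measure.ext fun T hT => ?_⟩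
  have hsplit : μ T = ∑ j, μ (T ∩ D j) := by
    rw [← tsum_fintype (L := .unconditional _), ← measure_iUnion
      (fun i j hij => (hdisj hij).mono Set.inter_subset_right Set.inter_subset_right)
      (fun j => hT.inter (hD j)), ← Set.inter_iUnion]
    refine (measure_inter_add_sdiff T (.iUnion hD)).symm.trans ?_
    rw [hnull _ (hT.diff (.iUnion hD)) (fun k hk => hk.2 (hcover k)), add_zero]
  rw [Measure.map_apply hy hT, Measure.sum_apply _ (hy hT), tsum_fintype, hsplit]
  refine Finset.sum_congr rfl fun j _ => ?_
  have hmem : ∀ k, y k ∈ D j → (y j ∈ T ↔ y k ∈ T) := fun k hk =>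
    hBsep j k (Set.mem_iInter.1 hk.1 k) T hT
  by_cases hj : y j ∈ T
  · have h0 : μ (D j \ T) = 0 := hnull _ ((hD j).diff hT) fun k hk =>
      hk.2 ((hmem k hk.1).1 hj)
    have h1 := measure_inter_add_sdiff (μ := μ) (D j) hT
    rw [h0, add_zero, Set.inter_comm] at h1
    simp [hj, h1]
  · have h0 : μ (T ∩ D j) = 0 := hnull _ (hT.inter (hD j)) fun k hk =>
      hj ((hmem k hk.2).2 hk.1)
    simp [hj, h0]

theorem Measure.pi_real_eq_sum {ι κ : Type*} [Fintype ι] [Fintype κ] [MeasurableSpace ι]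
    [MeasurableSingletonClass ι] (ν : Measure ι) [IsProbabilityMeasure ν] (s : Finset (κ → ι)) :
    (Measure.pi fun _ : κ => ν).real s = ∑ D ∈ s, ∏ i, ν.real {D i} := by
  rw [← sum_measureReal_singleton]
  refine Finset.sum_congr rfl fun D _ => ?_
  simp [measureReal_def, Measure.pi_singleton, ENNReal.toReal_prod]

/-- Refined occupancy bound. If `Y_1,…,Y_n` are i.i.d. from a distribution
supported on `m` distinct atoms, and `I` is the number of distinct values observed, then
for `r = ⌈( n(n−1)/(n+2m) − 2√( n(n−1)/(n+2m) · log(1/α₀) ) )₊⌉`, we have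
`P(I ≤ n − r) ≥ 1 − α₀`. -/
theorem occupancy_bound_refined
    {A : Type*} [MeasurableSpace A] [DecidableEq A]
    (m n : ℕ) (hm : 1 ≤ m) (hn : 1 ≤ n)
    (y : Fin m → A) (hy : Function.Injective y)
    (PY : Measure A) [IsProbabilityMeasure PY]
    (hsupp : PY {a | ∃ j, a = y j} = 1)
    (α₀ : ℝ) (hα₀ : α₀ ∈ Set.Ioo (0 : ℝ) 1)
    (r : ℕ)
    (hr : r = ⌈max ((n : ℝ) * ((n : ℝ) - 1) / ((n : ℝ) + 2 * m)
        - 2 * Real.sqrt ((n : ℝ) * ((n : ℝ) - 1) / ((n : ℝ) + 2 * m)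
            * Real.log (1 / α₀))) 0⌉₊) :
    ENNReal.ofReal (1 - α₀) ≤
      Measure.pi (fun _ : Fin n => PY)
        {D | ((Finset.image D Finset.univ).card : ℤ) ≤ (n : ℤ) - (r : ℤ)} := by
  have : Nonempty (Fin m) := ⟨⟨0, hm⟩⟩
  have hrange : PY (Set.range y) = 1 := by
    rw [← hsupp]
    congr 1
    ext a
    simp [eq_comm]
  obtain ⟨ν, rfl⟩ := exists_map_eq_of_measure_range_eq_one y PY hrange
  have hym : Measurable y := measurable_of_countable y
  have hν : IsProbabilityMeasure ν :=
    (Measure.isProbabilityMeasure_map_iff hym.aemeasurable).1 inferInstance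
  have hpi : Measurable fun (D : Fin n → Fin m) i => y (D i) :=
    measurable_pi_lambda _ fun i => hym.comp (measurable_pi_apply i)
  rw [← Measure.pi_map_pi (fun _ => hym.aemeasurable)]
  refine le_trans ?_ (Measure.le_map_apply hpi.aemeasurable _)
  have himg : ∀ D : Fin n → Fin m, (Finset.image (fun i => y (D i)) Finset.univ).card =
      (Finset.image D Finset.univ).card := fun D => by
    rw [← Finset.card_image_of_injective (Finset.image D Finset.univ) hy, Finset.image_image]
    rfl
  set E := {D : Fin n → Fin m | ((Finset.image D Finset.univ).card : ℤ) ≤ (n : ℤ) - (r : ℤ)}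
  have hpre : (fun (D : Fin n → Fin m) i => y (D i)) ⁻¹'
      {D | ((Finset.image D Finset.univ).card : ℤ) ≤ (n : ℤ) - (r : ℤ)} = E := by
    ext D
    simp only [Set.mem_preimage, Set.mem_ofPred_eq, E, himg]
  rw [hpre, ← ofReal_measureReal]
  refine ENNReal.ofReal_le_ofReal ?_
  have hE : MeasurableSet E := .of_discrete
  have hbad : (Measure.pi fun _ : Fin n => ν).real Eᶜ ≤ α₀ := by
    have hlog : 0 ≤ Real.log (1 / α₀) := Real.log_nonneg (by
      rw [le_div_iff₀ hα₀.1]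
      linarith [hα₀.2])
    have key := sum_collisions_lt_le hn (fun j : Fin m => ν.real {j}) (fun _ => measureReal_nonneg)
      (by rw [sum_measureReal_singleton]; simp) hlog (by rw [Fintype.card_fin])
    rw [one_div, Real.log_inv, neg_neg, Real.exp_log hα₀.1, ← Measure.pi_real_eq_sum] at key
    refine (measureReal_mono fun D hD => ?_).trans key
    have hcard : (Finset.image D Finset.univ).card ≤ n := by
      simpa using Finset.card_image_le (s := Finset.univ) (f := D)
    have hlt : n - (Finset.image D Finset.univ).card < r := by
      simp only [E, Set.mem_compl_iff, Set.mem_ofPred_eq, not_le] at hD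
      omega
    rw [hr, Nat.lt_ceil, Nat.cast_sub hcard, lt_max_iff] at hlt
    have hcard' : ((Finset.image D Finset.univ).card : ℝ) ≤ n := by exact_mod_cast hcard
    simpa using hlt.resolve_right (by linarith)
  rw [probReal_compl_eq_one_sub hE] at hbad
  linarith
end

section
/- Let P and Q be probability distributions on a measurable space Z such that Q is absolutely continuous with respect to P and dQ/dP(z) ≤ ε^{−1} for P-almost every z, for some ε ∈ (0,1). Let P̃ denote the distribution on Z × {0,1} obtained by sampling Z ∼ P and then B | Z ∼ Bernoulli( ε · dQ/dP(Z) ). Then for any integers N ≥ n ≥ 1 and any measurable function f : Z^n → [0,1], we have 0 ≤ E_{Q^n}[f] − E_{P̃^N}[ ∑_{1 ≤ i_1 < ⋯ < i_n ≤ N} f(Z_{i_1},…,Z_{i_n}) · 1{B_{i_1} = ⋯ = B_{i_n} = 1} / ( max{1, C(∑_{i=1}^N B_i, n)} ) ] ≤ P( Binomial(N, ε) < n ), where C(k,n) = k choose n and ((Z_1,B_1),…,(Z_N,B_N)) are i.i.d. from P̃. -/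
open MeasureTheory
open scoped ENNReal NNReal BigOperators

open ProbabilityTheory

section Acceptance

variable {Z : Type*} [MeasurableSpace Z]

theorem measurableSet_snd_eq (b : Bool) : MeasurableSet {p : Z × Bool | p.2 = b} :=
  measurable_snd (measurableSet_singleton b)

theorem measurableSet_forall_accept {ι κ : Type*} [Countable κ] (e : κ → ι) :
    MeasurableSet {W : ι → Z × Bool | ∀ k, (W (e k)).2 = true} := by
  rw [Set.ofPred_forall]
  exact MeasurableSet.iInter fun k =>
    (measurable_snd.comp (measurable_pi_apply (e k))) (measurableSet_singleton true)

theorem map_fst_restrict_accept {P Q : Measure Z} [SigmaFinite P] [SigmaFinite Q] (hac : Q ≪ P)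
    {c : ℝ≥0∞} {Pt : Measure (Z × Bool)}
    (hPt : ∀ s : Set (Z × Bool), MeasurableSet s →
      Pt s = ∫⁻ z, (c * Q.rnDeriv P z) * s.indicator 1 (z, true)
          + (1 - c * Q.rnDeriv P z) * s.indicator 1 (z, false) ∂P) :
    (Pt.restrict {p | p.2 = true}).map Prod.fst = c • Q := by
  ext A hA
  rw [Measure.map_apply measurable_fst hA, Measure.restrict_apply (measurable_fst hA),
    hPt _ ((measurable_fst hA).inter (measurableSet_snd_eq true)), Measure.smul_apply, smul_eq_mul]
  conv_rhs => rw [← Measure.withDensity_rnDeriv_eq Q P hac, withDensity_apply _ hA]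
  rw [← lintegral_const_mul _ (Measure.measurable_rnDeriv Q P), ← lintegral_indicator hA]
  refine lintegral_congr fun z => ?_
  by_cases hz : z ∈ A <;> simp [Set.indicator, hz]

theorem pi_const_smul {ι : Type*} [Fintype ι] (Q : Measure Z) [IsFiniteMeasure Q] {c : ℝ≥0∞}
    (hc : c ≠ ∞) :
    Measure.pi (fun _ : ι => c • Q) = c ^ Fintype.card ι • Measure.pi fun _ : ι => Q := by
  have : IsFiniteMeasure (c • Q) := Measure.smul_finite Q hc
  refine Measure.pi_eq fun s _ => ?_
  simp [Finset.prod_mul_distrib]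

theorem integral_pi_all_accept {n : ℕ} {Q : Measure Z} [IsFiniteMeasure Q]
    {c : ℝ≥0∞} (hc : c ≠ ∞) {Pt : Measure (Z × Bool)} [IsProbabilityMeasure Pt]
    (h : (Pt.restrict {p | p.2 = true}).map Prod.fst = c • Q)
    {f : (Fin n → Z) → ℝ} (hf : Measurable f) :
    ∫ W : Fin n → Z × Bool, (if ∀ i, (W i).2 = true then f (fun i => (W i).1) else 0)
        ∂(Measure.pi fun _ => Pt)
      = c.toReal ^ n * ∫ D, f D ∂(Measure.pi fun _ => Q) := by
  have hS : MeasurableSet (Set.univ.pi fun _ : Fin n => {p : Z × Bool | p.2 = true}) :=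
    MeasurableSet.univ_pi fun _ => measurableSet_snd_eq true
  have : IsFiniteMeasure (c • Q) := Measure.smul_finite Q hc
  have : ∀ _ : Fin n, SigmaFinite ((Pt.restrict {p | p.2 = true}).map Prod.fst) := fun _ => by
    rw [h]; infer_instance
  calc _ = ∫ W, (Set.univ.pi fun _ : Fin n => {p : Z × Bool | p.2 = true}).indicator
          (fun W => f fun i => (W i).1) W ∂(Measure.pi fun _ => Pt) := by
        congr 1 with W
        simp [Set.indicator, Set.mem_pi]
    _ = ∫ W, f (fun i => (W i).1)
          ∂(Measure.pi fun _ : Fin n => Pt.restrict {p : Z × Bool | p.2 = true}) := by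
        rw [integral_indicator hS, Measure.restrict_pi_pi]
    _ = ∫ D, f D ∂(Measure.pi fun _ : Fin n => c • Q) := by
        have hm := Measure.pi_map_pi (ι := Fin n) (f := fun _ => Prod.fst)
          (μ := fun _ => Pt.restrict {p : Z × Bool | p.2 = true})
          (fun _ => measurable_fst.aemeasurable)
        simp only [h] at hm
        rw [← hm, integral_map (Measurable.aemeasurable (by fun_prop)) hf.aestronglyMeasurable]
    _ = _ := by
        rw [pi_const_smul Q hc, Fintype.card_fin, integral_smul_measure, smul_eq_mul, ENNReal.toReal_pow]

theorem integral_pi_accept_mul {ι : Type*} [Fintype ι] [DecidableEq ι] {Q : Measure Z}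
    [IsFiniteMeasure Q] {c : ℝ≥0∞} (hc : c ≠ ∞) {Pt : Measure (Z × Bool)} [IsProbabilityMeasure Pt]
    (h : (Pt.restrict {p | p.2 = true}).map Prod.fst = c • Q)
    {n : ℕ} {s : Finset ι} (e : Fin n → ι) (he : e.Injective) (hes : ∀ k, e k ∈ s)
    {f : (Fin n → Z) → ℝ} (hf : Measurable f)
    {g : ((i : ↥sᶜ) → Z × Bool) → ℝ} (hg : Measurable g) :
    ∫ W : ι → Z × Bool, (if ∀ k, (W (e k)).2 = true then f (fun k => (W (e k)).1) else 0)
        * g (fun i => W i) ∂(Measure.pi fun _ => Pt)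
      = (c.toReal ^ n * ∫ D, f D ∂(Measure.pi fun _ => Q)) *
        ∫ W : ι → Z × Bool, g (fun i => W i) ∂(Measure.pi fun _ => Pt) := by
  classical
  have hind : iIndepFun (fun (i : ι) (W : ι → Z × Bool) => W i) (Measure.pi fun _ => Pt) :=
    iIndepFun_pi (X := fun _ => id) fun _ => aemeasurable_id
  have hI := hind.indepFun_finset s sᶜ disjoint_compl_right (fun i => measurable_pi_apply i)
  have hF : Measurable fun x : Fin n → Z × Bool =>
      if ∀ k, (x k).2 = true then f (fun k => (x k).1) else 0 :=
    Measurable.ite (measurableSet_forall_accept id) (hf.comp (by fun_prop)) measurable_const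
  have hF' : Measurable fun x : ↥s → Z × Bool =>
      if ∀ k, (x ⟨e k, hes k⟩).2 = true then f (fun k => (x ⟨e k, hes k⟩).1) else 0 :=
    hF.comp (f := fun (x : ↥s → Z × Bool) k => x ⟨e k, hes k⟩) (by fun_prop)
  have key := hI.integral_fun_comp_mul_comp (𝕜 := ℝ)
    (f := fun x => if ∀ k, (x ⟨e k, hes k⟩).2 = true then f (fun k => (x ⟨e k, hes k⟩).1) else 0)
    (g := g) (Measurable.aemeasurable (by fun_prop)) (Measurable.aemeasurable (by fun_prop))
    hF'.aestronglyMeasurable hg.aestronglyMeasurable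
  rw [key]
  congr 1
  have hmap : (Measure.pi fun _ : ι => Pt).map (fun W k => W (e k))
      = Measure.pi fun _ : Fin n => Pt := by
    rw [(iIndepFun_iff_map_fun_eq_pi_map (fun k => (measurable_pi_apply (e k)).aemeasurable)).1
      (hind.precomp he)]
    congr 1 with k : 1
    exact (measurePreserving_eval (fun _ : ι => Pt) (e k)).map_eq
  have := integral_pi_all_accept hc h hf
  rw [← hmap, integral_map (Measurable.aemeasurable (by fun_prop)) hF.aestronglyMeasurable] at this
  exact this

/-- The accepted positions of a sample. -/
def accepted {ι : Type*} [Fintype ι] (W : ι → Z × Bool) : Finset ι :=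
  Finset.univ.filter fun i => (W i).2 = true

theorem measurableSet_accepted_mem {ι : Type*} [Fintype ι] (A : Set (Finset ι)) :
    MeasurableSet {W : ι → Z × Bool | accepted W ∈ A} := by
  have h : Measurable fun W : ι → Z × Bool => fun i => (W i).2 := by fun_prop
  exact h (t := {b | (Finset.univ.filter fun i => b i = true) ∈ A}) (Set.toFinite _).measurableSet

theorem measureReal_accepted_eq {ι : Type*} [Fintype ι] {Pt : Measure (Z × Bool)}
    [IsProbabilityMeasure Pt] (T : Finset ι) :
    (Measure.pi fun _ : ι => Pt).real {W | accepted W = T}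
      = Pt.real {p | p.2 = true} ^ T.card
        * (1 - Pt.real {p | p.2 = true}) ^ (Fintype.card ι - T.card) := by
  classical
  have hset : {W : ι → Z × Bool | accepted W = T}
      = Set.univ.pi fun i => if i ∈ T then {p | p.2 = true} else {p | p.2 = true}ᶜ := by
    ext W
    simp only [Set.mem_ofPred_eq, accepted, Finset.ext_iff, Finset.mem_filter, Finset.mem_univ,
      true_and, Set.mem_pi, Set.mem_univ, forall_const]
    refine forall_congr' fun i => ?_
    by_cases hi : i ∈ T <;> simp [hi]
  rw [hset, measureReal_def, Measure.pi_pi, ENNReal.toReal_prod]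
  have : ∀ i, (Pt (if i ∈ T then {p | p.2 = true} else {p | p.2 = true}ᶜ)).toReal
      = if i ∈ T then Pt.real {p | p.2 = true} else 1 - Pt.real {p | p.2 = true} := by
    intro i
    split_ifs
    · rfl
    · exact probReal_compl_eq_one_sub (measurableSet_snd_eq true)
  simp only [this, Finset.prod_ite, Finset.prod_const]
  rw [Finset.filter_not, Finset.filter_univ_mem, Finset.card_univ_sdiff]

theorem measureReal_card_accepted_lt {ι : Type*} [Fintype ι] {Pt : Measure (Z × Bool)}
    [IsProbabilityMeasure Pt] (n : ℕ) :
    (Measure.pi fun _ : ι => Pt).real {W | (accepted W).card < n}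
      = ∑ k ∈ Finset.range n, ((Fintype.card ι).choose k : ℝ) * Pt.real {p | p.2 = true} ^ k
        * (1 - Pt.real {p | p.2 = true}) ^ (Fintype.card ι - k) := by
  classical
  have hset : {W : ι → Z × Bool | (accepted W).card < n}
      = ⋃ T ∈ (Finset.range n).biUnion fun k => Finset.univ.powersetCard k,
          {W : ι → Z × Bool | accepted W = T} := by
    ext W; simp
  rw [hset, measureReal_biUnion_finset, Finset.sum_biUnion]
  · refine Finset.sum_congr rfl fun k _ => ?_
    rw [Finset.sum_congr rfl (g := fun _ => Pt.real {p | p.2 = true} ^ k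
        * (1 - Pt.real {p | p.2 = true}) ^ (Fintype.card ι - k))]
    · simp [Finset.card_powersetCard, mul_assoc]
    · intro T hT
      rw [measureReal_accepted_eq, (Finset.mem_powersetCard.1 hT).2]
  · exact fun a _ b _ hab => Finset.pairwise_disjoint_powersetCard _ hab
  · intro S _ T _ hST
    refine Set.disjoint_left.2 fun W hW hW' => hST ?_
    exact hW.symm.trans hW'
  · exact fun T _ => measurableSet_accepted_mem {T}

end Acceptance

/-- The average of `f` over the `n`-element sets of accepted positions, normalized by the number of
such sets (or by one if there are none). -/
noncomputable def acceptedAverage {Z : Type*} {n N : ℕ} (f : (Fin n → Z) → ℝ)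
    (W : Fin N → Z × Bool) : ℝ :=
  ∑ s ∈ Finset.univ.powersetCard n,
    if h : s.card = n ∧ ∀ i ∈ s, (W i).2 = true then
      f (fun k => (W (s.orderEmbOfFin h.1 k)).1) /
        (max 1 ((Finset.univ.filter fun i => (W i).2 = true).card.choose n) : ℝ)
    else 0

section Average

variable {Z : Type*} [MeasurableSpace Z] {n N : ℕ}

theorem acceptedAverage_one (W : Fin N → Z × Bool) :
    acceptedAverage (fun _ : Fin n → Z => 1) W = if n ≤ (accepted W).card then 1 else 0 := by
  have h : acceptedAverage (fun _ : Fin n → Z => 1) W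
      = ∑ s ∈ (accepted W).powersetCard n, 1 / (max 1 ((accepted W).card.choose n) : ℝ) := by
    rw [acceptedAverage]
    refine (Finset.sum_subset_zero_on_sdiff (Finset.powersetCard_mono (Finset.subset_univ _))
      ?_ ?_).symm
    · intro s hs
      simp only [Finset.mem_sdiff, Finset.mem_powersetCard, Finset.subset_univ, true_and] at hs
      rw [dif_neg]
      rintro ⟨h1, h2⟩
      exact hs.2 ⟨fun i hi => by simpa [accepted] using h2 i hi, h1⟩
    · intro s hs
      rw [Finset.mem_powersetCard] at hs
      rw [dif_pos ⟨hs.2, fun i hi => by simpa [accepted] using hs.1 hi⟩]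
      rfl
  rw [h, Finset.sum_const, Finset.card_powersetCard, nsmul_eq_mul, mul_one_div]
  split_ifs with hn
  · have : (1 : ℝ) ≤ ((accepted W).card.choose n : ℝ) := by
      exact_mod_cast Nat.choose_pos hn
    rw [max_eq_right this, div_self (by positivity)]
  · rw [Nat.choose_eq_zero_of_lt (not_le.1 hn)]; simp

/-- The inverse normalization, as a function of the positions outside `s` when all positions of `s`
are accepted. -/
noncomputable def outsideWeight (n : ℕ) (s : Finset (Fin N)) (b : ↥sᶜ → Bool) : ℝ :=
  1 / (max 1 ((Finset.univ.filter fun i => ∀ h : i ∈ sᶜ, b ⟨i, h⟩ = true).card.choose n) : ℝ)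

theorem measurable_outsideWeight (s : Finset (Fin N)) :
    Measurable fun y : ↥sᶜ → Z × Bool => outsideWeight n s fun i => (y i).2 :=
  (Measurable.of_discrete (f := outsideWeight n s)).comp (by fun_prop)

theorem integrable_accept_mul_outsideWeight (μ : Measure (Fin N → Z × Bool)) [IsFiniteMeasure μ]
    (s : Finset (Fin N)) (e : Fin n → Fin N) {f : (Fin n → Z) → ℝ} (hf : Measurable f)
    (hf01 : ∀ D, f D ∈ Set.Icc (0 : ℝ) 1) :
    Integrable (fun W => (if ∀ k, (W (e k)).2 = true then f (fun k => (W (e k)).1) else 0)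
      * outsideWeight n s fun i => (W i).2) μ := by
  have hF : Measurable fun W : Fin N → Z × Bool =>
      if ∀ k, (W (e k)).2 = true then f (fun k => (W (e k)).1) else 0 :=
    Measurable.ite (measurableSet_forall_accept e) (hf.comp (by fun_prop)) measurable_const
  have hG : Measurable fun W : Fin N → Z × Bool => outsideWeight n s fun i => (W i).2 :=
    (Measurable.of_discrete (f := outsideWeight n s)).comp (by fun_prop)
  refine Integrable.of_bound (C := 1) (hF.mul hG).aestronglyMeasurable (ae_of_all _ fun W => ?_)
  have h1 : |outsideWeight n s fun i => (W i).2| ≤ 1 := by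
    rw [outsideWeight, abs_of_nonneg (by positivity)]
    exact div_le_one_of_le₀ (le_max_left _ _) (by positivity)
  rw [Real.norm_eq_abs, abs_mul]
  refine mul_le_one₀ ?_ (abs_nonneg _) h1
  split_ifs
  · rw [abs_of_nonneg (hf01 _).1]; exact (hf01 _).2
  · simp

theorem acceptedAverage_eq (f : (Fin n → Z) → ℝ) (W : Fin N → Z × Bool) :
    acceptedAverage f W = ∑ s ∈ (Finset.univ.powersetCard n : Finset (Finset (Fin N))).attach,
      (if ∀ k, (W (s.1.orderEmbOfFin (Finset.mem_powersetCard.1 s.2).2 k)).2 = true then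
        f (fun k => (W (s.1.orderEmbOfFin (Finset.mem_powersetCard.1 s.2).2 k)).1) else 0)
      * outsideWeight n s.1 (fun i => (W i).2) := by
  rw [acceptedAverage, ← Finset.sum_attach]
  refine Finset.sum_congr rfl fun ⟨s, hs⟩ _ => ?_
  have hcard := (Finset.mem_powersetCard.1 hs).2
  have hiff : (∀ k, (W (s.orderEmbOfFin hcard k)).2 = true) ↔ ∀ i ∈ s, (W i).2 = true := by
    constructor
    · intro h i hi
      rw [← Finset.mem_coe, ← Finset.range_orderEmbOfFin s hcard] at hi
      obtain ⟨k, rfl⟩ := hi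
      exact h k
    · exact fun h k => h _ (Finset.orderEmbOfFin_mem s hcard k)
  by_cases h : ∀ i ∈ s, (W i).2 = true
  · rw [dif_pos ⟨hcard, h⟩, if_pos (hiff.2 h), outsideWeight, mul_one_div]
    congr 5
    ext i
    by_cases hi : i ∈ s <;> simp [hi, h]
  · rw [dif_neg (fun h' => h h'.2), if_neg (fun h' => h (hiff.1 h')), zero_mul]

theorem integral_acceptedAverage {Q : Measure Z} [IsProbabilityMeasure Q] {c : ℝ≥0∞} (hc : c ≠ ∞)
    {Pt : Measure (Z × Bool)} [IsProbabilityMeasure Pt]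
    (h : (Pt.restrict {p | p.2 = true}).map Prod.fst = c • Q)
    {f : (Fin n → Z) → ℝ} (hf : Measurable f) (hf01 : ∀ D, f D ∈ Set.Icc (0 : ℝ) 1) :
    ∫ W : Fin N → Z × Bool, acceptedAverage f W ∂(Measure.pi fun _ => Pt)
      = (∫ D, f D ∂(Measure.pi fun _ => Q)) * (1 - (Measure.pi fun _ : Fin N => Pt).real
          {W | (accepted W).card < n}) := by
  have expand : ∀ {f : (Fin n → Z) → ℝ}, Measurable f → (∀ D, f D ∈ Set.Icc (0 : ℝ) 1) →
      ∫ W : Fin N → Z × Bool, acceptedAverage f W ∂(Measure.pi fun _ => Pt)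
        = (∫ D, f D ∂(Measure.pi fun _ => Q)) *
          ∑ s ∈ (Finset.univ.powersetCard n : Finset (Finset (Fin N))).attach, c.toReal ^ n *
            ∫ W : Fin N → Z × Bool, outsideWeight n s.1 (fun i => (W i).2)
              ∂(Measure.pi fun _ => Pt) := by
    intro f hf hf01
    simp only [acceptedAverage_eq]
    rw [integral_finsetSum, Finset.mul_sum]
    · refine Finset.sum_congr rfl fun s _ => ?_
      rw [integral_pi_accept_mul hc h _ (RelEmbedding.injective _)
        (Finset.orderEmbOfFin_mem s.1 _) hf (measurable_outsideWeight _)]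
      ring
    · exact fun s _ => integrable_accept_mul_outsideWeight _ s.1 _ hf hf01
  have hms : MeasurableSet {W : Fin N → Z × Bool | (accepted W).card < n} :=
    measurableSet_accepted_mem {T | T.card < n}
  have one := expand (f := fun _ => 1) measurable_const fun _ => by simp
  rw [integral_const, probReal_univ, one_smul, one_mul] at one
  rw [expand hf hf01, ← one, ← probReal_compl_eq_one_sub hms, ← integral_indicator_one hms.compl]
  congr 2 with W
  simp [acceptedAverage_one, Set.indicator]

end Average

/-- Rejection sampling lemma. Let `Q ≪ P` with `dQ/dP ≤ ε⁻¹` `P`-a.e., and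
let `P̃` be the distribution of `(Z, B)` where `Z ∼ P` and `B | Z ∼ Bernoulli(ε·dQ/dP(Z))`.
Then for any `N ≥ n ≥ 1` and any measurable `f : Z^n → [0,1]`, the difference
`E_{Q^n}[f] − E_{P̃^N}[ ∑_{i_1<⋯<i_n} f(Z_{i_1},…,Z_{i_n}) · 1{B_{i_1}=⋯=B_{i_n}=1} /
max{1, C(∑_i B_i, n)} ]` lies in `[0, P(Binomial(N,ε) < n)]`. -/
theorem rejection_sampling_bound
    {Z : Type*} [MeasurableSpace Z]
    (P Q : Measure Z) [IsProbabilityMeasure P] [IsProbabilityMeasure Q]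
    (ε : ℝ) (hε : ε ∈ Set.Ioo (0 : ℝ) 1)
    (hac : Q ≪ P)
    (hbound : ∀ᵐ z ∂P, Q.rnDeriv P z ≤ ENNReal.ofReal (1 / ε))
    (Pt : Measure (Z × Bool)) [IsProbabilityMeasure Pt]
    (hPt : ∀ s : Set (Z × Bool), MeasurableSet s →
      Pt s = ∫⁻ z,
          (ENNReal.ofReal ε * Q.rnDeriv P z) * s.indicator 1 (z, true)
          + (1 - ENNReal.ofReal ε * Q.rnDeriv P z) * s.indicator 1 (z, false) ∂P)
    (n N : ℕ) (hn : 1 ≤ n) (hnN : n ≤ N)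
    (f : (Fin n → Z) → ℝ) (hf : Measurable f) (hf01 : ∀ D, f D ∈ Set.Icc (0 : ℝ) 1) :
    (∫ D, f D ∂(Measure.pi fun _ : Fin n => Q))
      - (∫ W : Fin N → Z × Bool,
          (∑ s ∈ Finset.univ.powersetCard n,
            if h : s.card = n ∧ ∀ i ∈ s, (W i).2 = true then
              f (fun k => (W (s.orderEmbOfFin h.1 k)).1) /
                (max 1 ((Finset.univ.filter fun i => (W i).2 = true).card.choose n) : ℝ)
            else 0)
          ∂(Measure.pi fun _ : Fin N => Pt))
      ∈ Set.Icc (0 : ℝ)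
        (∑ k ∈ Finset.range n, (N.choose k : ℝ) * ε ^ k * (1 - ε) ^ (N - k)) := by
  obtain ⟨hε0, -⟩ := hε
  have hacc := map_fst_restrict_accept hac hPt
  have hreal : Pt.real {p | p.2 = true} = ε := by
    have := congrArg (fun μ : Measure Z => μ Set.univ) hacc
    simp only [Measure.map_apply measurable_fst MeasurableSet.univ, Set.preimage_univ,
      Measure.restrict_apply_univ, Measure.smul_apply, measure_univ, smul_eq_mul, mul_one] at this
    rw [measureReal_def, this, ENNReal.toReal_ofReal hε0.le]
  have hint := integral_acceptedAverage (N := N) ENNReal.ofReal_ne_top hacc hf hf01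
  have hlt := measureReal_card_accepted_lt (ι := Fin N) (Pt := Pt) n
  rw [hreal, Fintype.card_fin] at hlt
  simp only [acceptedAverage] at hint
  rw [hint, ← hlt]
  have hm0 : 0 ≤ ∫ D, f D ∂(Measure.pi fun _ : Fin n => Q) :=
    integral_nonneg fun D => (hf01 D).1
  have hm1 : ∫ D, f D ∂(Measure.pi fun _ : Fin n => Q) ≤ 1 := by
    have := integral_mono_of_nonneg (μ := Measure.pi fun _ : Fin n => Q)
      (ae_of_all _ fun D => (hf01 D).1) (integrable_const (1 : ℝ)) (ae_of_all _ fun D => (hf01 D).2)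
    simpa using this
  have hp : 0 ≤ (Measure.pi fun _ : Fin N => Pt).real {W | (accepted W).card < n} :=
    measureReal_nonneg
  constructor <;> nlinarith
end
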